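/- arXiv:0908.2350 — 4 statements merged into one kernel-verified Lean document; each statement's English description precedes it below -/
import Mathlib

section
/- Let v ∈ ℝ². If the orbit {a_t u_v SL₃(ℤ) : t > 0} is dense in the quotient space SL₃(ℝ)/SL₃(ℤ) (with the quotient topology), then v is not Dirichlet improvable and v has property C. -/
open Matrix

/-- `SL₃(ℝ)`. -/
abbrev SL3R := Matrix.SpecialLinearGroup (Fin 3) ℝ

/-- `SL₃(ℤ)` viewed as a subgroup of `SL₃(ℝ)`. -/
def SL3Z : Subgroup SL3R :=
  (Matrix.SpecialLinearGroup.map (n := Fin 3) (Int.castRingHom ℝ)).range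

/-- `a_t = diag(e^t, e^t, e^{−2t}) ∈ SL₃(ℝ)`. -/
noncomputable def aMat3 (t : ℝ) : SL3R :=
  ⟨Matrix.diagonal ![Real.exp t, Real.exp t, Real.exp (-(2 * t))], by
    simp [Matrix.det_diagonal, Fin.prod_univ_three, ← Real.exp_add]
    ring_nf⟩

/-- `u_v = [[1,0,−v₁],[0,1,−v₂],[0,0,1]] ∈ SL₃(ℝ)`. -/
def uMat3 (v : Fin 2 → ℝ) : SL3R :=
  ⟨!![1, 0, -v 0; 0, 1, -v 1; 0, 0, 1], by simp [Matrix.det_fin_three, Matrix.vecHead, Matrix.vecTail]⟩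

/-- The quotient `SL₃(ℝ)/SL₃(ℤ)` carries the quotient topology (the topology on
`SL₃(ℝ)` being the subspace topology from the matrices). -/
noncomputable instance : TopologicalSpace SL3R :=
  TopologicalSpace.induced (fun g => (g : Matrix (Fin 3) (Fin 3) ℝ)) inferInstance

/-- The distance from a real number to the nearest integer. -/
noncomputable def intDist (x : ℝ) : ℝ := |x - (round x : ℤ)|

/-- A vector `v ∈ ℝ²` is Dirichlet improvable. -/
def IsDI (v : Fin 2 → ℝ) : Prop :=
  ∃ μ₀ : ℝ, 0 < μ₀ ∧ μ₀ < 1 ∧ ∃ N₀ : ℝ, ∀ N : ℝ, N₀ ≤ N →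
    ∃ (m : Fin 2 → ℤ) (k : ℕ), 0 < k ∧ (k : ℝ) ≤ N ^ 2 ∧
      ∀ i, |(k : ℝ) * v i - (m i : ℝ)| < μ₀ / N

/-- Property C of the first type. -/
def PropCFirst (v : Fin 2 → ℝ) : Prop :=
  ∀ γ δ M : ℝ, 0 < δ → 0 < M → ∃ n₁ n₂ : ℤ,
    M < (|n₁ * n₂| : ℤ) ∧
    ((|n₁ * n₂| : ℤ) : ℝ) * intDist ((n₁ : ℝ) * v 0 + (n₂ : ℝ) * v 1 - γ) < δ

/-- Property C of the second type. -/
def PropCSecond (v : Fin 2 → ℝ) : Prop :=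
  ∀ γ₁ γ₂ δ M : ℝ, 0 < δ → 0 < M → ∃ n : ℤ,
    M < (|n| : ℤ) ∧
    ((|n| : ℤ) : ℝ) * intDist ((n : ℝ) * v 0 - γ₁) * intDist ((n : ℝ) * v 1 - γ₂) < δ

/-- A lattice in `ℝ³` stable under multiplication by two independent totally positive units, whose
coordinates are cyclic permutations of `A`, `B`, `C`. -/
structure UnitLattice where
  L : AddSubgroup (Fin 3 → ℝ)
  A : ℝ
  B : ℝ
  C : ℝ
  one_mem : 1 ∈ L
  covering : ∃ R : ℝ, 0 < R ∧ ∀ y, ∃ l ∈ L, ‖y - l‖ ≤ R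
  discrete : ∃ ρ : ℝ, 0 < ρ ∧ ∀ l ∈ L, ‖l‖ < ρ → l = 0
  one_lt_A : 1 < A
  B_lt_one : B < 1
  C_lt_B : C < B
  C_pos : 0 < C
  mul_eq_one : A * B * C = 1
  mul_mem₁ : ∀ l ∈ L, ![A, B, C] * l ∈ L
  inv_mul_mem₁ : ∀ l ∈ L, ![A⁻¹, B⁻¹, C⁻¹] * l ∈ L
  mul_mem₂ : ∀ l ∈ L, ![C, A, B] * l ∈ L
  inv_mul_mem₂ : ∀ l ∈ L, ![C⁻¹, A⁻¹, B⁻¹] * l ∈ L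

namespace UnitLattice
open Filter Topology

variable (D : UnitLattice)

lemma A_pos : 0 < D.A := one_pos.trans D.one_lt_A

lemma B_pos : 0 < D.B := D.C_pos.trans D.C_lt_B

/-- The unit with exponents `p` with respect to the two basic units. -/
noncomputable def u (p : ℤ × ℤ) : Fin 3 → ℝ :=
  ![D.A ^ p.1 * D.C ^ p.2, D.B ^ p.1 * D.A ^ p.2, D.C ^ p.1 * D.B ^ p.2]

lemma u_add (p q : ℤ × ℤ) : D.u (p + q) = D.u p * D.u q := by
  have hA := D.A_pos.ne'
  have hB := D.B_pos.ne'
  have hC := D.C_pos.ne'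
  ext i
  fin_cases i <;> simp [u, zpow_add₀ hA, zpow_add₀ hB, zpow_add₀ hC] <;> ring

lemma u_zero : D.u 0 = 1 := by
  ext i; fin_cases i <;> simp [u]

lemma u_pos (p : ℤ × ℤ) (i : Fin 3) : 0 < D.u p i := by
  have hA := D.A_pos
  have hB := D.B_pos
  have hC := D.C_pos
  fin_cases i <;> simp [u] <;> positivity

lemma u_prod (p : ℤ × ℤ) : D.u p 0 * D.u p 1 * D.u p 2 = 1 := by
  have : D.u p 0 * D.u p 1 * D.u p 2 = (D.A * D.B * D.C) ^ p.1 * (D.A * D.B * D.C) ^ p.2 := by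
    simp only [u, mul_zpow]
    simp
    ring
  rw [this, D.mul_eq_one]; simp

lemma u_neg_mul (p : ℤ × ℤ) : D.u (-p) * D.u p = 1 := by
  rw [← u_add, neg_add_cancel, u_zero]

lemma u_neg_apply (p : ℤ × ℤ) (i : Fin 3) : D.u (-p) i = (D.u p i)⁻¹ :=
  eq_inv_of_mul_eq_one_left (congrFun (D.u_neg_mul p) i)

lemma u_nsmul (n : ℕ) (p : ℤ × ℤ) : D.u (n • p) = D.u p ^ n := by
  induction n with
  | zero => simp [u_zero]
  | succ n ih => rw [add_smul, one_smul, u_add, ih, pow_succ]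

lemma u_mul_mem (p : ℤ × ℤ) : ∀ l ∈ D.L, D.u p * l ∈ D.L := by
  let S : AddSubmonoid (ℤ × ℤ) :=
    { carrier := {p | ∀ l ∈ D.L, D.u p * l ∈ D.L}
      zero_mem' := by simp [u_zero]
      add_mem' := by
        intro a b ha hb l hl
        rw [u_add, mul_assoc]
        exact ha _ (hb _ hl) }
  have h1 : ((1 : ℤ), (0 : ℤ)) ∈ S := fun l hl => by
    simpa [u] using D.mul_mem₁ l hl
  have h2 : ((-1 : ℤ), (0 : ℤ)) ∈ S := fun l hl => by
    simpa [u] using D.inv_mul_mem₁ l hl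
  have h3 : ((0 : ℤ), (1 : ℤ)) ∈ S := fun l hl => by
    simpa [u] using D.mul_mem₂ l hl
  have h4 : ((0 : ℤ), (-1 : ℤ)) ∈ S := fun l hl => by
    simpa [u] using D.inv_mul_mem₂ l hl
  have key : ∀ q ∈ S, -q ∈ S → ∀ n : ℤ, n • q ∈ S := by
    intro q hq hq' n
    obtain ⟨k, rfl | rfl⟩ := n.eq_nat_or_neg
    · simpa using S.nsmul_mem hq k
    · simpa using S.nsmul_mem hq' k
  have h5 := S.add_mem (key _ h1 (by simpa using h2) p.1) (key _ h3 (by simpa using h4) p.2)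
  have h6 : p.1 • ((1 : ℤ), (0 : ℤ)) + p.2 • ((0 : ℤ), (1 : ℤ)) = p := by
    ext <;> simp
  rw [h6] at h5
  exact h5

lemma u_mem (p : ℤ × ℤ) : D.u p ∈ D.L := by
  simpa using D.u_mul_mem p 1 D.one_mem

/-- For each coordinate there is a unit contracting the other two coordinates. -/
lemma exists_contracting (i : Fin 3) : ∃ p : ℤ × ℤ, 1 < D.u p i ∧ ∀ j, j ≠ i → D.u p j < 1 := by
  have hA := D.one_lt_A
  have hB := D.B_lt_one
  have hC := D.C_lt_B
  have hA0 := D.A_pos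
  have hB0 := D.B_pos
  have hC0 := D.C_pos
  have hm := D.mul_eq_one
  have hAC : D.A * D.C = D.B⁻¹ := by field_simp; linarith
  have hAB : D.A * D.B = D.C⁻¹ := by field_simp; linarith
  have hBC : D.B * D.C = D.A⁻¹ := by field_simp; linarith
  fin_cases i
  · refine ⟨(1, 0), by simpa [u] using hA, fun j hj => ?_⟩
    fin_cases j <;> simp [u] at hj ⊢ <;> linarith
  · refine ⟨(0, 1), by simpa [u] using hA, fun j hj => ?_⟩
    fin_cases j <;> simp [u] at hj ⊢ <;> linarith
  · refine ⟨-(1, 1), ?_, fun j hj => ?_⟩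
    · have : D.u (1, 1) 2 = D.A⁻¹ := by simp [u, ← hBC, mul_comm]
      change 1 < D.u (-(1, 1)) 2
      rwa [u_neg_apply, this, inv_inv]
    · fin_cases j
      · have : D.u (1, 1) 0 = D.B⁻¹ := by simp [u, hAC]
        change D.u (-(1, 1)) 0 < 1
        rwa [u_neg_apply, this, inv_inv]
      · have : D.u (1, 1) 1 = D.C⁻¹ := by simp [u, ← hAB, mul_comm]
        change D.u (-(1, 1)) 1 < 1
        rw [u_neg_apply, this, inv_inv]
        exact hC.trans hB
      · simp at hj

/-- A lattice point with a vanishing coordinate vanishes. -/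
lemma eq_zero_of_apply_eq_zero {l : Fin 3 → ℝ} (hl : l ∈ D.L) (i : Fin 3) (h : l i = 0) :
    l = 0 := by
  obtain ⟨p, -, hp⟩ := D.exists_contracting i
  obtain ⟨ρ, hρ, hd⟩ := D.discrete
  have ht : Filter.Tendsto (fun n : ℕ => D.u (n • p) * l) Filter.atTop (nhds 0) := by
    rw [tendsto_pi_nhds]
    intro j
    simp only [u_nsmul, Pi.mul_apply, Pi.pow_apply, Pi.zero_apply]
    by_cases hj : j = i
    · subst hj; simp [h]
    · have := tendsto_pow_atTop_nhds_zero_of_lt_one (D.u_pos p j).le (hp j hj)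
      simpa using this.mul_const (l j)
  have := (ht.eventually (Metric.ball_mem_nhds 0 hρ)).exists
  obtain ⟨n, hn⟩ := this
  have h0 := hd _ (D.u_mul_mem (n • p) l hl) (by simpa using hn)
  have := congrArg (fun x => D.u (-(n • p)) * x) h0
  simpa [← mul_assoc, u_neg_mul] using this

lemma log_A_pos : 0 < Real.log D.A := Real.log_pos D.one_lt_A

lemma log_B_neg : Real.log D.B < 0 := Real.log_neg D.B_pos D.B_lt_one

lemma log_add : Real.log D.A + Real.log D.B + Real.log D.C = 0 := by
  rw [← Real.log_mul D.A_pos.ne' D.B_pos.ne', ← Real.log_mul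
    (mul_pos D.A_pos D.B_pos).ne' D.C_pos.ne', D.mul_eq_one, Real.log_one]

lemma log_indep (p q : ℤ) (h : p * Real.log D.A + q * Real.log D.B = 0) : p = 0 ∧ q = 0 := by
  have hA := D.A_pos
  have hB := D.B_pos
  have hC := D.C_pos
  have h1 : D.u (q, p) 1 = 1 := by
    simp only [u]
    simp
    apply Real.eq_one_of_pos_of_log_eq_zero (by positivity)
    rw [Real.log_mul (by positivity) (by positivity), Real.log_zpow, Real.log_zpow]
    linarith
  have h2 : D.u (q, p) - 1 = 0 :=
    D.eq_zero_of_apply_eq_zero (D.L.sub_mem (D.u_mem _) D.one_mem) 1 (by simp [h1])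
  have h3 : D.u (q, p) = 1 := by rwa [sub_eq_zero] at h2
  have e0 := congrArg Real.log (congrFun h3 0)
  have e2 := congrArg Real.log (congrFun h3 2)
  simp only [u, Matrix.cons_val, Pi.one_apply, Real.log_one] at e0 e2
  rw [Real.log_mul (by positivity) (by positivity), Real.log_zpow, Real.log_zpow] at e0 e2
  have ha := D.log_A_pos
  have hb := D.log_B_neg
  have hc : Real.log D.C < 0 := Real.log_neg hC (D.C_lt_B.trans D.B_lt_one)
  have hpq : (p : ℝ) = 0 ∧ (q : ℝ) = 0 := by
    generalize (p : ℝ) = p at *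
    generalize (q : ℝ) = q at *
    have : q * (Real.log D.A * Real.log D.B - Real.log D.C ^ 2) = 0 := by
      linear_combination Real.log D.B * e0 - Real.log D.C * e2
    have hq : q = 0 := by
      rcases mul_eq_zero.1 this with h | h
      · exact h
      · nlinarith [mul_neg_of_pos_of_neg ha hb, sq_nonneg (Real.log D.C)]
    subst hq
    refine ⟨?_, rfl⟩
    have : p * Real.log D.C = 0 := by linarith
    rcases mul_eq_zero.1 this with h | h
    · exact h
    · linarith
  exact_mod_cast hpq

/-- A subgroup of exponents containing a multiple of both basis vectors. -/
def Good (H : AddSubgroup (ℤ × ℤ)) : Prop := ∃ k : ℕ, 0 < k ∧ ((k : ℤ), (0 : ℤ)) ∈ H ∧ ((0 : ℤ), (k : ℤ)) ∈ H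

lemma Good.inf {H K : AddSubgroup (ℤ × ℤ)} (hH : Good H) (hK : Good K) : Good (H ⊓ K) := by
  obtain ⟨k, hk, h1, h2⟩ := hH
  obtain ⟨m, hm, h3, h4⟩ := hK
  refine ⟨k * m, by positivity, ⟨?_, ?_⟩, ⟨?_, ?_⟩⟩
  · simpa [mul_comm] using H.nsmul_mem h1 m
  · simpa using K.nsmul_mem h3 k
  · simpa [mul_comm] using H.nsmul_mem h2 m
  · simpa using K.nsmul_mem h4 k

lemma Good.exists_smul_mem {H : AddSubgroup (ℤ × ℤ)} (hH : Good H) :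
    ∃ k : ℕ, 0 < k ∧ ∀ p : ℤ × ℤ, k • p ∈ H := by
  obtain ⟨k, hk, h1, h2⟩ := hH
  refine ⟨k, hk, fun p => ?_⟩
  have h6 : p.1 • ((k : ℤ), (0 : ℤ)) + p.2 • ((0 : ℤ), (k : ℤ)) = k • p := by
    ext <;> simp [mul_comm]
  rw [← h6]
  exact H.add_mem (H.zsmul_mem h1 _) (H.zsmul_mem h2 _)

/-- A linear form injective on exponents takes arbitrarily small positive values on `H`. -/
lemma Good.exists_small {H : AddSubgroup (ℤ × ℤ)} (hH : Good H) {α β : ℝ}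
    (hind : ∀ p q : ℤ, p * α + q * β = 0 → p = 0 ∧ q = 0) {η : ℝ} (hη : 0 < η) :
    ∃ p ∈ H, 0 < p.1 * α + p.2 * β ∧ p.1 * α + p.2 * β < η := by
  obtain ⟨k, hk, hkH⟩ := hH.exists_smul_mem
  have hβ : β ≠ 0 := fun h => by
    have := (hind 0 1 (by simp [h])).2
    simp at this
  have hirr : Irrational (α / β) := by
    rw [irrational_iff_ne_rational]
    intro a b hb hab
    have hb' : (b : ℝ) ≠ 0 := by exact_mod_cast hb
    rw [div_eq_div_iff hβ hb'] at hab
    have := (hind b (-a) (by push_cast; linarith)).1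
    exact hb this
  have hd := (dense_addSubgroupClosure_pair_iff).2 hirr
  have hk' : (0 : ℝ) < k := by exact_mod_cast hk
  obtain ⟨x, hx1, hx2⟩ := hd.exists_between (show (0 : ℝ) < η / k by positivity)
  obtain ⟨m, n, rfl⟩ := AddSubgroup.mem_closure_pair.1 hx1
  refine ⟨k • (m, n), hkH _, ?_⟩
  have h1 := hx2.1
  have h2 := hx2.2
  simp only [zsmul_eq_mul] at h1 h2
  rw [lt_div_iff₀ hk'] at h2
  simp only [Prod.smul_mk, nsmul_eq_mul]
  push_cast
  constructor
  · have := mul_pos hk' h1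
    linarith
  · linarith

lemma log_u_apply (i : Fin 3) : ∃ α β : ℝ, (∀ p q : ℤ, p * α + q * β = 0 → p = 0 ∧ q = 0) ∧
    ∀ p, Real.log (D.u p i) = p.1 * α + p.2 * β := by
  have hA := D.A_pos
  have hB := D.B_pos
  have hC := D.C_pos
  have hs := D.log_add
  have hc : Real.log D.C = -Real.log D.A - Real.log D.B := by linarith
  have hlog : ∀ {x y : ℝ}, 0 < x → 0 < y → ∀ p : ℤ × ℤ,
      Real.log (x ^ p.1 * y ^ p.2) = p.1 * Real.log x + p.2 * Real.log y := by
    intro x y hx hy p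
    rw [Real.log_mul (by positivity) (by positivity), Real.log_zpow, Real.log_zpow]
  fin_cases i
  · refine ⟨Real.log D.A, Real.log D.C, fun p q h => ?_, fun p => hlog hA hC p⟩
    have := D.log_indep (p - q) (-q) (by push_cast; rw [hc] at h; linarith)
    omega
  · refine ⟨Real.log D.B, Real.log D.A, fun p q h => ?_, fun p => hlog hB hA p⟩
    have := D.log_indep q p (by linarith)
    omega
  · refine ⟨Real.log D.C, Real.log D.B, fun p q h => ?_, fun p => hlog hC hB p⟩
    have := D.log_indep (-p) (q - p) (by push_cast; rw [hc] at h; linarith)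
    omega

lemma log_u_ratio : ∃ α β : ℝ, (∀ p q : ℤ, p * α + q * β = 0 → p = 0 ∧ q = 0) ∧
    ∀ p, Real.log (D.u p 1 / D.u p 0) = p.1 * α + p.2 * β := by
  have hA := D.A_pos
  have hB := D.B_pos
  have hC := D.C_pos
  have hs := D.log_add
  refine ⟨Real.log D.B - Real.log D.A, Real.log D.A - Real.log D.C, fun p q h => ?_, fun p => ?_⟩
  · have hc : Real.log D.C = -Real.log D.A - Real.log D.B := by linarith
    have := D.log_indep (2 * q - p) (p + q) (by push_cast; rw [hc] at h; linarith)
    omega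
  · simp only [u, Matrix.cons_val_one, Matrix.cons_val_zero]
    rw [Real.log_div (by positivity) (by positivity), Real.log_mul (by positivity) (by positivity),
      Real.log_mul (by positivity) (by positivity)]
    simp only [Real.log_zpow]
    ring

/-- Units of `H` move a small positive number close to a given one in the coordinate `i`, while
contracting it in the other coordinates. -/
lemma exists_unit_near {H : AddSubgroup (ℤ × ℤ)} (hH : Good H) (i : Fin 3) {t η : ℝ}
    (ht : 0 < t) (hη : 0 < η) :
    ∃ σ > 0, ∀ s, 0 < s → s < σ → ∃ p ∈ H, |D.u p i * s - t| < η ∧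
      ∀ j, j ≠ i → D.u p j * s < η := by
  obtain ⟨α, β, hind, hlog⟩ := D.log_u_apply i
  obtain ⟨h, hhH, hh0, hh1⟩ := hH.exists_small hind (show 0 < η / t by positivity)
  rw [← hlog] at hh0 hh1
  obtain ⟨k, hk, hkH⟩ := hH.exists_smul_mem
  obtain ⟨c, hc1, hc2⟩ := D.exists_contracting i
  obtain ⟨g, hg⟩ : ∃ g, g = k • c := ⟨_, rfl⟩
  have hgi : 1 < D.u g i := by
    rw [hg, u_nsmul]; exact one_lt_pow₀ hc1 hk.ne'
  have hgj : ∀ j, j ≠ i → D.u g j ≤ 1 := fun j hj => by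
    rw [hg, u_nsmul]; exact pow_le_one₀ (D.u_pos c j).le (hc2 j hj).le
  set x := Real.log (D.u h i) with hx
  set G := Real.log (D.u g i) with hG
  have hG0 : 0 < G := Real.log_pos hgi
  obtain ⟨J, hJ⟩ := exists_nat_ge (G / x)
  set K := (max 1 ‖D.u h‖) ^ J with hK
  have hK1 : 1 ≤ K := one_le_pow₀ (le_max_left _ _)
  refine ⟨min t (η / K), by positivity, fun s hs hsσ => ?_⟩
  have hst := hsσ.trans_le (min_le_left _ _)
  have hsη := hsσ.trans_le (min_le_right _ _)
  set T := Real.log (t / s) with hT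
  have hT0 : 0 ≤ T := Real.log_nonneg (by rw [le_div_iff₀ hs]; linarith)
  set N := ⌊T / G⌋₊ with hN
  have hN1 : N * G ≤ T := by
    have := Nat.floor_le (div_nonneg hT0 hG0.le)
    rwa [le_div_iff₀ hG0] at this
  have hN2 : T < (N + 1) * G := by
    have := Nat.lt_floor_add_one (T / G)
    rwa [div_lt_iff₀ hG0] at this
  set j := ⌊(T - N * G) / x⌋₊ with hj
  have hj1 : j * x ≤ T - N * G := by
    have := Nat.floor_le (div_nonneg (sub_nonneg.2 hN1) hh0.le)
    rwa [le_div_iff₀ hh0] at this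
  have hj2 : T - N * G < (j + 1) * x := by
    have := Nat.lt_floor_add_one ((T - N * G) / x)
    rwa [div_lt_iff₀ hh0] at this
  have hjJ : j ≤ J := by
    have : (j : ℝ) ≤ G / x := by
      rw [le_div_iff₀ hh0]; linarith
    exact_mod_cast this.trans hJ
  refine ⟨N • g + j • h, H.add_mem (H.nsmul_mem (hg ▸ hkH _) _) (H.nsmul_mem hhH _), ?_, ?_⟩
  · have hpos := D.u_pos (N • g + j • h) i
    have hl : Real.log (D.u (N • g + j • h) i) = N * G + j * x := by
      rw [u_add, u_nsmul, u_nsmul]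
      simp only [Pi.mul_apply, Pi.pow_apply]
      rw [Real.log_mul (pow_pos (D.u_pos _ _) _).ne' (pow_pos (D.u_pos _ _) _).ne',
        Real.log_pow, Real.log_pow]
    have hTe : Real.exp T * s = t := by
      rw [hT, Real.exp_log (by positivity)]; field_simp
    have hue : D.u (N • g + j • h) i = Real.exp (N * G + j * x) := by
      rw [← hl, Real.exp_log hpos]
    rw [hue]
    have e1 : Real.exp (N * G + j * x) ≤ Real.exp T := Real.exp_le_exp.2 (by linarith)
    have e2 : Real.exp T * Real.exp (-x) ≤ Real.exp (N * G + j * x) := by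
      rw [← Real.exp_add]; exact Real.exp_le_exp.2 (by linarith)
    have e3 : 1 - x ≤ Real.exp (-x) := by
      have := Real.add_one_le_exp (-x); linarith
    have e4 : t * x < η := by rw [lt_div_iff₀ ht] at hh1; linarith
    have e5 : Real.exp T * s * (1 - x) ≤ Real.exp (N * G + j * x) * s := by
      calc Real.exp T * s * (1 - x) ≤ Real.exp T * s * Real.exp (-x) := by gcongr
        _ = (Real.exp T * Real.exp (-x)) * s := by ring
        _ ≤ _ := by gcongr
    have e6 : Real.exp (N * G + j * x) * s ≤ t := by
      rw [← hTe]; gcongr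
    rw [hTe] at e5
    rw [abs_lt]
    constructor <;> nlinarith
  · intro b hb
    rw [u_add, u_nsmul, u_nsmul]
    simp only [Pi.mul_apply, Pi.pow_apply]
    have f1 : D.u g b ^ N ≤ 1 := pow_le_one₀ (D.u_pos _ _).le (hgj b hb)
    have f2 : D.u h b ^ j ≤ K := by
      calc D.u h b ^ j ≤ (max 1 ‖D.u h‖) ^ j := by
            apply pow_le_pow_left₀ (D.u_pos _ _).le
            exact ((le_abs_self _).trans (norm_le_pi_norm (D.u h) b)).trans (le_max_right _ _)
        _ ≤ K := pow_le_pow_right₀ (le_max_left _ _) hjJ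
    have f3 : 0 < D.u h b ^ j := pow_pos (D.u_pos _ _) _
    calc D.u g b ^ N * D.u h b ^ j * s ≤ 1 * K * s := by gcongr
      _ < η := by
        rw [lt_div_iff₀ (by positivity)] at hsη; linarith

/-- Every open half-axis is dense modulo the lattice. -/
lemma exists_axis_near (i : Fin 3) (r : Fin 3 → ℝ) {η : ℝ} (hη : 0 < η) :
    ∃ t > 0, ∃ l ∈ D.L, ‖Pi.single i t - l - r‖ < η := by
  obtain ⟨R, hR, hcov⟩ := D.covering
  obtain ⟨c, hc1, hc2⟩ := D.exists_contracting i
  have hN : ∀ᶠ N : ℕ in atTop, ∀ j, j ≠ i → D.u c j ^ N * R < η := by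
    rw [eventually_all]
    intro j
    by_cases hj : j = i
    · simp [hj]
    · have := (tendsto_pow_atTop_nhds_zero_of_lt_one (D.u_pos c j).le (hc2 j hj)).mul_const R
      rw [zero_mul] at this
      filter_upwards [this.eventually (gt_mem_nhds hη)] with N hN _ using hN
  obtain ⟨N, hN⟩ := hN.exists
  have hui := D.u_pos (N • c)
  obtain ⟨m, hm, hmy⟩ := hcov (Pi.single i (R + 1) - D.u (-(N • c)) * r)
  have hb : ∀ j, |(Pi.single i (R + 1) : Fin 3 → ℝ) j - (D.u (N • c) j)⁻¹ * r j - m j| ≤ R := by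
    intro j
    have := (norm_le_pi_norm _ j).trans hmy
    simpa [u_neg_apply] using this
  refine ⟨D.u (N • c) i * m i + r i, ?_, D.u (N • c) * m, D.u_mul_mem _ _ hm, ?_⟩
  · have h1 := (abs_le.1 (hb i)).2
    simp only [Pi.single_eq_same] at h1
    have h2 : 0 < m i + (D.u (N • c) i)⁻¹ * r i := by linarith
    have h3 := mul_pos (hui i) h2
    rw [mul_add, ← mul_assoc, mul_inv_cancel₀ (hui i).ne', one_mul] at h3
    exact h3
  · rw [pi_norm_lt_iff hη]
    intro j
    by_cases hj : j = i
    · subst hj; simp [hη]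
    · have h1 := hb j
      simp only [Pi.single_eq_of_ne hj, Pi.sub_apply, Pi.mul_apply, Real.norm_eq_abs] at h1 ⊢
      have h2 : 0 - D.u (N • c) j * m j - r j
          = D.u (N • c) j * (0 - (D.u (N • c) j)⁻¹ * r j - m j) := by
        have := (hui j).ne'
        field_simp
        ring
      rw [h2, abs_mul, abs_of_pos (hui j)]
      have h3 := hN j hj
      rw [u_nsmul] at h1 ⊢
      simp only [Pi.pow_apply] at h1 ⊢
      exact (mul_le_mul_of_nonneg_left h1 (pow_pos (D.u_pos c j) _).le).trans_lt h3

lemma eventually_unit_near_of_max {H : AddSubgroup (ℤ × ℤ)} (hH : Good H) (r : Fin 3 → ℝ) {η : ℝ}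
    (hη : 0 < η) (i : Fin 3) : ∀ᶠ z : Fin 3 → ℝ in 𝓝 0, 0 < z i → (∀ j, |z j| ≤ z i) →
      ∃ p ∈ H, ∃ l ∈ D.L, ‖D.u p * z - l - r‖ < η := by
  obtain ⟨t, ht, l, hl, hlr⟩ := D.exists_axis_near i r (half_pos hη)
  obtain ⟨σ, hσ, hs⟩ := D.exists_unit_near hH i ht (half_pos hη)
  have : ∀ᶠ z : Fin 3 → ℝ in 𝓝 0, z i < σ :=
    (continuous_apply i).continuousAt.eventually (gt_mem_nhds (by simpa using hσ))
  filter_upwards [this] with z hz hz0 hmax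
  obtain ⟨p, hp, h1, h2⟩ := hs (z i) hz0 hz
  refine ⟨p, hp, l, hl, ?_⟩
  have h3 : ‖D.u p * z - Pi.single i t‖ < η / 2 := by
    rw [pi_norm_lt_iff (half_pos hη)]
    intro j
    by_cases hj : j = i
    · subst hj; simpa using h1
    · simp only [Pi.sub_apply, Pi.mul_apply, Pi.single_eq_of_ne hj, sub_zero, Real.norm_eq_abs,
        abs_mul, abs_of_pos (D.u_pos p j)]
      exact (mul_le_mul_of_nonneg_left (hmax j) (D.u_pos p j).le).trans_lt (h2 j hj)
  calc ‖D.u p * z - l - r‖ = ‖(D.u p * z - Pi.single i t) + (Pi.single i t - l - r)‖ := by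
        congr 1; abel
    _ ≤ _ := norm_add_le _ _
    _ < η := by linarith

/-- The units in `H` spread every small nonzero vector densely modulo the lattice. -/
lemma eventually_unit_near {H : AddSubgroup (ℤ × ℤ)} (hH : Good H) (r : Fin 3 → ℝ) {η : ℝ}
    (hη : 0 < η) : ∀ᶠ z : Fin 3 → ℝ in 𝓝 0, z ≠ 0 →
      ∃ p ∈ H, ∃ l ∈ D.L, ‖D.u p * z - l - r‖ < η := by
  have h1 := eventually_all.2 (D.eventually_unit_near_of_max hH r hη)
  have h2 := eventually_all.2 (D.eventually_unit_near_of_max hH (-r) hη)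
  have hneg : Tendsto (fun z : Fin 3 → ℝ => -z) (𝓝 0) (𝓝 0) := by
    simpa using (continuous_neg (G := Fin 3 → ℝ)).tendsto 0
  filter_upwards [h1, hneg.eventually h2] with z hz1 hz2 hz
  obtain ⟨i, -, hi⟩ := Finset.exists_max_image Finset.univ (fun j => |z j|) Finset.univ_nonempty
  have hi0 : z i ≠ 0 := by
    intro h0
    apply hz
    ext j
    have := hi j (Finset.mem_univ _)
    rw [h0, abs_zero] at this
    simpa using this
  rcases lt_or_gt_of_ne hi0 with hneg | hpos
  · obtain ⟨p, hp, l, hl, h⟩ := hz2 i (by simpa using hneg) (fun j => by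
      have := hi j (Finset.mem_univ _)
      rw [abs_of_neg hneg] at this
      simpa using this)
    refine ⟨p, hp, -l, D.L.neg_mem hl, ?_⟩
    rw [← norm_neg]
    have e : -(D.u p * z - -l - r) = D.u p * -z - l - -r := by rw [mul_neg]; abel
    rwa [e]
  · exact hz1 i hpos (fun j => by
      have := hi j (Finset.mem_univ _)
      rwa [abs_of_pos hpos] at this)

lemma exists_subseq_mod (x : ℕ → Fin 3 → ℝ) : ∃ l : ℕ → Fin 3 → ℝ, (∀ n, l n ∈ D.L) ∧
    ∃ a, ∃ φ : ℕ → ℕ, StrictMono φ ∧ Tendsto (fun n => x (φ n) - l (φ n)) atTop (𝓝 a) := by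
  obtain ⟨R, hR, hcov⟩ := D.covering
  choose l hl hlR using fun n => hcov (x n)
  refine ⟨l, hl, ?_⟩
  obtain ⟨a, -, φ, hφ, h⟩ := (isCompact_closedBall (0 : Fin 3 → ℝ) R).tendsto_subseq
    (x := fun n => x n - l n) (fun n => by simpa using hlR n)
  exact ⟨a, φ, hφ, h⟩

lemma exists_lt_close_mod (x : ℕ → Fin 3 → ℝ) {η : ℝ} (hη : 0 < η) :
    ∃ i j, i < j ∧ ∃ l ∈ D.L, ‖x i - x j - l‖ < η := by
  obtain ⟨l, hl, a, φ, hφ, h⟩ := D.exists_subseq_mod x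
  obtain ⟨N, hN⟩ := Metric.tendsto_atTop.1 h _ (half_pos hη)
  have h1 := hN N le_rfl
  have h2 := hN (N + 1) (Nat.le_succ N)
  rw [dist_eq_norm] at h1 h2
  refine ⟨φ N, φ (N + 1), hφ (Nat.lt_succ_self N), l (φ N) - l (φ (N + 1)),
    D.L.sub_mem (hl _) (hl _), ?_⟩
  calc _ = ‖(x (φ N) - l (φ N) - a) - (x (φ (N + 1)) - l (φ (N + 1)) - a)‖ := by
        congr 1; abel
    _ ≤ _ := norm_sub_le _ _
    _ < η := by linarith

/-- The exponents of the units fixing `y` modulo the lattice. -/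
def stab (y : Fin 3 → ℝ) : AddSubgroup (ℤ × ℤ) where
  carrier := {p | D.u p * y - y ∈ D.L}
  zero_mem' := by simp [u_zero]
  add_mem' := by
    intro p q hp hq
    have := D.L.add_mem (D.u_mul_mem p _ hq) hp
    have e : D.u p * (D.u q * y - y) + (D.u p * y - y) = D.u (p + q) * y - y := by
      rw [u_add]; ring
    rwa [e] at this
  neg_mem' := by
    intro p hp
    have := D.L.neg_mem (D.u_mul_mem (-p) _ hp)
    have e : -(D.u (-p) * (D.u p * y - y)) = D.u (-p) * y - y := by
      linear_combination (-y) * D.u_neg_mul p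
    rwa [e] at this

lemma mem_stab {y : Fin 3 → ℝ} {p : ℤ × ℤ} : p ∈ D.stab y ↔ D.u p * y - y ∈ D.L := Iff.rfl

lemma sub_smul_mem_stab {y : Fin 3 → ℝ} {e : ℤ × ℤ} {i j : ℕ} (hij : i < j)
    (h : D.u (i • e) * y - D.u (j • e) * y ∈ D.L) : (j - i) • e ∈ D.stab y := by
  have := D.L.neg_mem (D.u_mul_mem (-(i • e)) _ h)
  have e1 : D.u (j • e) = D.u ((j - i) • e) * D.u (i • e) := by
    rw [← u_add, ← add_smul, Nat.sub_add_cancel hij.le]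
  rw [mem_stab]
  convert this using 1
  rw [e1]
  linear_combination (y - D.u ((j - i) • e) * y) * D.u_neg_mul (i • e)

lemma good_stab_of_recurrent {y : Fin 3 → ℝ} {k : ℕ} (hk : 0 < k)
    (h : ∀ e ∈ ({((k : ℤ), (0 : ℤ)), ((0 : ℤ), (k : ℤ))} : Set (ℤ × ℤ)),
      ∃ i j : ℕ, i < j ∧ D.u (i • e) * y - D.u (j • e) * y ∈ D.L) : Good (D.stab y) := by
  obtain ⟨i, j, hij, h1⟩ := h _ (Or.inl rfl)
  obtain ⟨i', j', hij', h2⟩ := h _ (Or.inr rfl)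
  have h3 := D.sub_smul_mem_stab hij h1
  have h4 := D.sub_smul_mem_stab hij' h2
  refine ⟨(j - i) * (j' - i') * k, ?_, ?_, ?_⟩
  · have := Nat.sub_pos_of_lt hij
    have := Nat.sub_pos_of_lt hij'
    positivity
  · convert (D.stab y).nsmul_mem h3 (j' - i') using 1
    ext <;> simp; ring
  · convert (D.stab y).nsmul_mem h4 (j - i) using 1
    ext <;> simp; ring

/-- A set with no lattice-close pairs of distinct points has good stabilizers. -/
lemma good_stab_of_separated {y : Fin 3 → ℝ} {η : ℝ} (hη : 0 < η)
    (h : ∀ p q, ∀ l ∈ D.L, ‖D.u p * y - D.u q * y - l‖ < η → D.u p * y - D.u q * y - l = 0) :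
    Good (D.stab y) := by
  refine D.good_stab_of_recurrent one_pos fun e _ => ?_
  obtain ⟨i, j, hij, l, hl, hlt⟩ := D.exists_lt_close_mod (fun i : ℕ => D.u (i • e) * y) hη
  refine ⟨i, j, hij, ?_⟩
  rw [sub_eq_zero.1 (h _ _ l hl hlt)]
  exact hl

lemma good_stab_of_smul_mem {y : Fin 3 → ℝ} {N : ℕ} (hN : 0 < N) (hy : N • y ∈ D.L) :
    Good (D.stab y) := by
  obtain ⟨ρ, hρ, hd⟩ := D.discrete
  have hN' : (0 : ℝ) < N := by exact_mod_cast hN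
  refine D.good_stab_of_separated (div_pos hρ hN') fun p q l hl h => ?_
  have h1 : N • (D.u p * y - D.u q * y - l) ∈ D.L := by
    have := D.L.sub_mem (D.L.sub_mem (D.u_mul_mem p _ hy) (D.u_mul_mem q _ hy))
      (D.L.nsmul_mem hl N)
    convert this using 1
    simp only [smul_sub, mul_smul_comm]
  have h2 := hd _ h1 (by
    rw [lt_div_iff₀ hN'] at h
    rw [← Nat.cast_smul_eq_nsmul ℝ, norm_smul, Real.norm_of_nonneg hN'.le]
    linarith)
  exact (smul_eq_zero.1 h2).resolve_left hN.ne'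

/-- Closed sets invariant under the lattice and under the units in `H`. -/
structure IsInv (H : AddSubgroup (ℤ × ℤ)) (M : Set (Fin 3 → ℝ)) : Prop where
  closed : IsClosed M
  add_mem : ∀ y ∈ M, ∀ l ∈ D.L, y + l ∈ M
  mul_mem : ∀ p ∈ H, ∀ y ∈ M, D.u p * y ∈ M

/-- An invariant set without points of good stabilizer realizes all differences. -/
lemma IsInv.exists_add_mem {H : AddSubgroup (ℤ × ℤ)} (hH : Good H) {M : Set (Fin 3 → ℝ)}
    (hM : D.IsInv H M) (hne : M.Nonempty) (hns : ∀ y ∈ M, ¬ Good (D.stab y)) (r : Fin 3 → ℝ) :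
    ∃ p ∈ M, p + r ∈ M := by
  obtain ⟨y, hy⟩ := hne
  obtain ⟨k, hk, h1, h2⟩ := id hH
  obtain ⟨e, heH, he⟩ : ∃ e ∈ H, ∀ i j : ℕ, i < j → D.u (i • e) * y - D.u (j • e) * y ∉ D.L := by
    by_contra! hcon
    refine hns y hy (D.good_stab_of_recurrent hk ?_)
    rintro e (rfl | rfl)
    · exact hcon _ h1
    · exact hcon _ h2
  have key : ∀ n : ℕ, ∃ a ∈ M, ∃ b ∈ M, ‖a - b - r‖ < 1 / (n + 1 : ℝ) := by
    intro n
    obtain ⟨σ, hσ, hs⟩ := Metric.eventually_nhds_iff.1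
      (D.eventually_unit_near hH r (Nat.one_div_pos_of_nat (α := ℝ) (n := n)))
    obtain ⟨i, j, hij, l, hl, hlt⟩ := D.exists_lt_close_mod (fun i : ℕ => D.u (i • e) * y) hσ
    have hz : D.u (i • e) * y - D.u (j • e) * y - l ≠ 0 := fun h0 => he i j hij (by
      rw [sub_eq_zero.1 h0]; exact hl)
    obtain ⟨p, hp, l', hl', h⟩ := hs (y := D.u (i • e) * y - D.u (j • e) * y - l)
      (by rw [dist_zero_right]; exact hlt) hz
    refine ⟨_, hM.mul_mem p hp _ (hM.mul_mem _ (H.nsmul_mem heH i) y hy), _,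
      hM.add_mem _ (hM.mul_mem p hp _ (hM.add_mem _ (hM.mul_mem _ (H.nsmul_mem heH j) y hy) l hl))
        l' hl', ?_⟩
    convert h using 2
    ring
  choose a ha b hb hab using key
  obtain ⟨l, hl, c, φ, hφ, hc⟩ := D.exists_subseq_mod b
  refine ⟨c, hM.closed.mem_of_tendsto hc (Eventually.of_forall fun n => ?_), ?_⟩
  · rw [sub_eq_add_neg]
    exact hM.add_mem _ (hb _) _ (D.L.neg_mem (hl _))
  · have h0 : Tendsto (fun n => a n - b n - r) atTop (𝓝 0) :=
      squeeze_zero_norm (fun n => (hab n).le) tendsto_one_div_add_atTop_nhds_zero_nat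
    have h3 := (hc.add (h0.comp hφ.tendsto_atTop)).add_const r
    rw [add_zero] at h3
    refine hM.closed.mem_of_tendsto h3 (Eventually.of_forall fun n => ?_)
    have := hM.add_mem _ (ha (φ n)) _ (D.L.neg_mem (hl (φ n)))
    convert this using 1
    simp only [Function.comp]
    abel

lemma IsInv.exists_progression {r : Fin 3 → ℝ} (hr : Good (D.stab r)) (n : ℕ) :
    ∀ {H : AddSubgroup (ℤ × ℤ)} {M : Set (Fin 3 → ℝ)}, Good H → D.IsInv H M → M.Nonempty →
      (∀ y ∈ M, ¬ Good (D.stab y)) → ∃ p ∈ M, ∀ j ≤ n, p + j • r ∈ M := by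
  induction n with
  | zero =>
    rintro H M - - ⟨p, hp⟩ -
    exact ⟨p, hp, fun j hj => by simpa [Nat.le_zero.1 hj] using hp⟩
  | succ n ih =>
    intro H M hH hM hne hns
    have hM' : D.IsInv (H ⊓ D.stab r) {m | m ∈ M ∧ m + r ∈ M} := by
      refine ⟨hM.closed.inter (hM.closed.preimage (continuous_add_const r)), ?_, ?_⟩
      · rintro y ⟨h1, h2⟩ l hl
        exact ⟨hM.add_mem _ h1 l hl, by rw [add_right_comm]; exact hM.add_mem _ h2 l hl⟩
      · rintro p ⟨hp, hpr⟩ y ⟨h1, h2⟩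
        refine ⟨hM.mul_mem p hp _ h1, ?_⟩
        have := hM.add_mem _ (hM.mul_mem p hp _ h2) _ (D.L.neg_mem hpr)
        convert this using 1
        ring
    obtain ⟨p, hp, hpr⟩ := hM.exists_add_mem D hH hne hns r
    obtain ⟨q, hq, hqj⟩ := ih (hH.inf hr) hM' ⟨p, hp, hpr⟩ fun y hy => hns y hy.1
    refine ⟨q, hq.1, fun j hj => ?_⟩
    rcases Nat.lt_or_ge j (n + 1) with h | h
    · exact (hqj j (Nat.lt_succ_iff.1 h)).1
    · obtain rfl : j = n + 1 := le_antisymm hj h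
      have := (hqj n le_rfl).2
      rwa [add_assoc, ← succ_nsmul] at this

/-- The product form, sheared by `s`. -/
def form (s : ℝ) (w : Fin 3 → ℝ) : ℝ := (w 0 + s * w 1) * w 1 * w 2

/-- The points `y` such that the form takes no nonzero value smaller than `δ` on `y + L`. -/
def Bad (δ s : ℝ) (y : Fin 3 → ℝ) : Prop := ∀ l ∈ D.L, form s (y + l) = 0 ∨ δ ≤ |form s (y + l)|

lemma continuous_form : Continuous fun x : ℝ × (Fin 3 → ℝ) => form x.1 x.2 := by
  unfold form; fun_prop

lemma isClosed_bad {δ : ℝ} : IsClosed {x : ℝ × (Fin 3 → ℝ) | D.Bad δ x.1 x.2} := by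
  have : {x : ℝ × (Fin 3 → ℝ) | D.Bad δ x.1 x.2} = ⋂ l ∈ D.L,
      {x : ℝ × (Fin 3 → ℝ) | form x.1 (x.2 + l) = 0} ∪ {x | δ ≤ |form x.1 (x.2 + l)|} := by
    ext x; simp [Bad]
  rw [this]
  refine isClosed_biInter fun l _ => ?_
  have hc : Continuous fun x : ℝ × (Fin 3 → ℝ) => form x.1 (x.2 + l) :=
    continuous_form.comp (by fun_prop : Continuous fun x : ℝ × (Fin 3 → ℝ) => (x.1, x.2 + l))
  exact (isClosed_eq hc continuous_const).union (isClosed_le continuous_const hc.abs)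

lemma Bad.add {δ s : ℝ} {y : Fin 3 → ℝ} (h : D.Bad δ s y) {l : Fin 3 → ℝ} (hl : l ∈ D.L) :
    D.Bad δ s (y + l) := fun m hm => by
  rw [add_assoc]; exact h _ (D.L.add_mem hl hm)

lemma form_u_mul (s : ℝ) (p : ℤ × ℤ) (w : Fin 3 → ℝ) :
    form (s * (D.u p 0 / D.u p 1)) (D.u p * w) = form s w := by
  have h := D.u_prod p
  have h1 := (D.u_pos p 1).ne'
  simp only [form, Pi.mul_apply]
  calc _ = (D.u p 0 * D.u p 1 * D.u p 2) * ((w 0 + s * w 1) * w 1 * w 2) := by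
        field_simp
    _ = _ := by rw [h, one_mul]

lemma u_mul_u_neg_mul (p : ℤ × ℤ) (l : Fin 3 → ℝ) : D.u p * (D.u (-p) * l) = l := by
  rw [← mul_assoc, ← u_add, add_neg_cancel, u_zero, one_mul]

lemma Bad.u_mul {δ s : ℝ} {y : Fin 3 → ℝ} (h : D.Bad δ s y) (p : ℤ × ℤ) :
    D.Bad δ (s * (D.u p 0 / D.u p 1)) (D.u p * y) := fun l hl => by
  have h1 := h _ (D.u_mul_mem (-p) l hl)
  rwa [← D.form_u_mul s p, mul_add, u_mul_u_neg_mul] at h1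

lemma isInv_bad (δ : ℝ) : D.IsInv ⊤ {y | D.Bad δ 0 y} := by
  refine ⟨?_, fun y hy l hl => Bad.add D hy hl, fun p _ y hy => ?_⟩
  · exact D.isClosed_bad.preimage (by fun_prop : Continuous fun y : Fin 3 → ℝ => ((0 : ℝ), y))
  · have := Bad.u_mul D hy p
    rwa [zero_mul] at this

lemma good_top : Good (⊤ : AddSubgroup (ℤ × ℤ)) := ⟨1, one_pos, trivial, trivial⟩

/-- An invariant set of bad points contains a point with good stabilizer. -/
lemma IsInv.exists_good_stab {H : AddSubgroup (ℤ × ℤ)} (hH : Good H) {M : Set (Fin 3 → ℝ)}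
    (hM : D.IsInv H M) (hne : M.Nonempty) {δ : ℝ} (hδ : 0 < δ) (hb : ∀ y ∈ M, D.Bad δ 0 y) :
    ∃ y ∈ M, Good (D.stab y) := by
  by_contra! hns
  obtain ⟨R, hR, hcov⟩ := D.covering
  obtain ⟨N, hN⟩ := exists_nat_gt (3 * (2 * R + 3) ^ 2 / δ)
  have hN0 : (0 : ℝ) < N := lt_of_le_of_lt (by positivity) hN
  have hN1 : 0 < N := by exact_mod_cast hN0
  have hN1' : (1 : ℝ) ≤ N := by exact_mod_cast hN1
  set r : Fin 3 → ℝ := fun _ => 1 / N with hr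
  have hrL : N • r ∈ D.L := by
    have : N • r = 1 := by
      ext i; simp [hr, hN0.ne']
    rw [this]; exact D.one_mem
  obtain ⟨p', hp', hpj'⟩ := hM.exists_progression D (D.good_stab_of_smul_mem hN1 hrL)
    (⌈2 * R * N⌉₊ + 4) hH hne hns
  obtain ⟨l, hl, hlR⟩ := hcov (p' + fun _ => R)
  set p := p' - l with hp
  have hpj : ∀ j ≤ ⌈2 * R * N⌉₊ + 4, p + j • r ∈ M := fun j hj => by
    have := hM.add_mem _ (hpj' j hj) _ (D.L.neg_mem hl)
    convert this using 1
    rw [hp]; abel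
  have hpi : ∀ i, -(2 * R) ≤ p i ∧ p i ≤ 0 := fun i => by
    have h1 := abs_le.1 ((norm_le_pi_norm _ i).trans hlR)
    simp only [Pi.sub_apply, Pi.add_apply] at h1
    simp only [hp, Pi.sub_apply]
    constructor <;> linarith
  set j₀ := ⌊-p 0 * N⌋₊ with hj₀
  have hj1 : (j₀ : ℝ) ≤ -p 0 * N := Nat.floor_le (mul_nonneg (by linarith [(hpi 0).2]) hN0.le)
  have hj2 : -p 0 * N < j₀ + 1 := Nat.lt_floor_add_one _
  have hj3 : j₀ ≤ ⌈2 * R * N⌉₊ := by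
    have h1 : (j₀ : ℝ) ≤ 2 * R * N :=
      hj1.trans (mul_le_mul_of_nonneg_right (by linarith [(hpi 0).1]) hN0.le)
    exact_mod_cast h1.trans (Nat.le_ceil _)
  have key : ∀ m : ℕ, m < 3 → p 1 + (j₀ + 1 + m) / N = 0 ∨ p 2 + (j₀ + 1 + m) / N = 0 := by
    intro m hm
    have hm' : (m : ℝ) ≤ 2 := by exact_mod_cast Nat.lt_succ_iff.1 hm
    have hm0 : (0 : ℝ) ≤ m := m.cast_nonneg
    have h1 := hb _ (hpj (j₀ + 1 + m) (by omega)) 0 D.L.zero_mem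
    have hval : form 0 (p + (j₀ + 1 + m) • r + 0) =
        (p 0 + (j₀ + 1 + m) / N) * (p 1 + (j₀ + 1 + m) / N) * (p 2 + (j₀ + 1 + m) / N) := by
      simp [form, hr, div_eq_mul_inv]
    rw [hval] at h1
    set q : ℝ := (j₀ + 1 + m) / N with hq
    have hq0 : 0 < p 0 + q := by
      have : p 0 + q = (p 0 * N + (j₀ + 1 + m)) / N := by rw [hq]; field_simp
      rw [this]
      exact div_pos (by linarith) hN0
    have hq3 : p 0 + q ≤ 3 / N := by
      have : p 0 + q = (p 0 * N + (j₀ + 1 + m)) / N := by rw [hq]; field_simp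
      rw [this]
      exact div_le_div_of_nonneg_right (by linarith) hN0.le
    have h3N : 3 / (N : ℝ) ≤ 3 := div_le_self (by norm_num) hN1'
    have hqi : ∀ i, |p i + q| ≤ 2 * R + 3 := fun i => by
      have hq00 : 0 ≤ q := by rw [hq]; positivity
      rw [abs_le]
      constructor <;> linarith [(hpi i).1, (hpi i).2, (hpi 0).1]
    have hlt : |(p 0 + q) * (p 1 + q) * (p 2 + q)| < δ := by
      rw [abs_mul, abs_mul, abs_of_pos hq0]
      calc _ ≤ 3 / N * (2 * R + 3) * (2 * R + 3) := by
            gcongr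
            · exact hqi 1
            · exact hqi 2
        _ < δ := by
            rw [div_lt_iff₀ hδ] at hN
            have : 3 / N * (2 * R + 3) * (2 * R + 3) = 3 * (2 * R + 3) ^ 2 / N := by ring
            rw [this, div_lt_iff₀ hN0]
            linarith
    rcases h1 with h1 | h1
    · rcases mul_eq_zero.1 h1 with h1 | h1
      · exact Or.inl ((mul_eq_zero.1 h1).resolve_left hq0.ne')
      · exact Or.inr h1
    · linarith
  have hinj : ∀ i (a b : ℕ), p i + (j₀ + 1 + a) / N = 0 → p i + (j₀ + 1 + b) / N = 0 → a = b := by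
    intro i a b ha hb
    have : (j₀ + 1 + a : ℝ) / N = (j₀ + 1 + b) / N := by linarith
    rw [div_left_inj' hN0.ne'] at this
    exact_mod_cast add_left_cancel this
  rcases key 0 (by norm_num) with h0 | h0 <;> rcases key 1 (by norm_num) with h1 | h1 <;>
    rcases key 2 (by norm_num) with h2 | h2 <;>
    first
    | exact absurd (hinj _ _ _ h0 h1) (by norm_num)
    | exact absurd (hinj _ _ _ h0 h2) (by norm_num)
    | exact absurd (hinj _ _ _ h1 h2) (by norm_num)

lemma u_mul_injective (p : ℤ × ℤ) : Function.Injective (D.u p * ·) := fun x y h => by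
  have := congrArg (D.u (-p) * ·) h
  simpa only [← mul_assoc, u_neg_mul, one_mul] using this

lemma isInv_derivedSet {M : Set (Fin 3 → ℝ)} (hM : D.IsInv ⊤ M) : D.IsInv ⊤ (derivedSet M) := by
  refine ⟨isClosed_derivedSet _, fun y hy l hl => ?_, fun p hp y hy => ?_⟩
  · rw [mem_derivedSet, accPt_iff_nhds] at hy ⊢
    intro U hU
    obtain ⟨z, ⟨hzU, hzM⟩, hz⟩ := hy _ ((continuous_add_const l).continuousAt.preimage_mem_nhds hU)
    exact ⟨z + l, ⟨hzU, hM.add_mem _ hzM l hl⟩, fun h => hz (add_right_cancel h)⟩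
  · rw [mem_derivedSet, accPt_iff_nhds] at hy ⊢
    intro U hU
    obtain ⟨z, ⟨hzU, hzM⟩, hz⟩ := hy _ ((continuous_const_mul (D.u p)).continuousAt.preimage_mem_nhds hU)
    exact ⟨D.u p * z, ⟨hzU, hM.mul_mem p hp z hzM⟩, fun h => hz (D.u_mul_injective p h)⟩

/-- Distinct bad points of the product form are uniformly separated. -/
lemma exists_separation {δ : ℝ} (hδ : 0 < δ) : ∃ ρ : ℝ, 0 < ρ ∧
    ∀ y z, D.Bad δ 0 y → D.Bad δ 0 (y + z) → ‖z‖ < ρ → z = 0 := by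
  have hinv := D.isInv_derivedSet (D.isInv_bad δ)
  have hsub : derivedSet {y | D.Bad δ 0 y} ⊆ {y | D.Bad δ 0 y} :=
    (isClosed_iff_derivedSet_subset _).1 (D.isInv_bad δ).closed
  have hemp : derivedSet {y | D.Bad δ 0 y} = ∅ := by
    by_contra hne
    obtain ⟨y, hy, hgood⟩ := hinv.exists_good_stab D good_top (Set.nonempty_iff_ne_empty.2 hne) hδ
      hsub
    have huniv : ∀ r, D.Bad δ 0 r := by
      intro r
      refine (D.isInv_bad δ).closed.closure_subset (Metric.mem_closure_iff.2 fun η hη => ?_)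
      have h1 := D.eventually_unit_near hgood (r - y) hη
      obtain ⟨σ, hσ, hs⟩ := Metric.eventually_nhds_iff.1 h1
      rw [mem_derivedSet, accPt_iff_nhds] at hy
      obtain ⟨x, ⟨hx1, hx2⟩, hxy⟩ := hy _ (Metric.ball_mem_nhds y hσ)
      obtain ⟨p, hp, l, hl, h⟩ := hs (y := x - y)
        (by rwa [dist_zero_right, ← dist_eq_norm]) (sub_ne_zero.2 hxy)
      have h2 := (D.isInv_bad δ).mul_mem p trivial x hx2
      have h3 := (D.isInv_bad δ).add_mem _ ((D.isInv_bad δ).add_mem _ h2 _ (D.L.neg_mem hl)) _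
        (D.L.neg_mem (D.mem_stab.1 hp))
      refine ⟨_, h3, ?_⟩
      rw [dist_comm, dist_eq_norm]
      have e : D.u p * x + -l + -(D.u p * y - y) - r = D.u p * (x - y) - l - (r - y) := by ring
      rwa [e]
    set t : ℝ := min 1 (δ / 2) with ht
    have ht0 : 0 < t := lt_min one_pos (half_pos hδ)
    have ht1 : t ≤ 1 := min_le_left _ _
    have ht2 : t ≤ δ / 2 := min_le_right _ _
    have h := huniv (fun _ => t) 0 D.L.zero_mem
    have hv : form 0 ((fun _ => t) + 0) = t * t * t := by simp [form]
    rw [hv, abs_of_pos (by positivity)] at h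
    rcases h with h | h
    · exact absurd h (by positivity)
    · have : t * t ≤ 1 := by nlinarith
      nlinarith
  by_contra! hcon
  choose y z hy hz hlt hne using fun n : ℕ => hcon (1 / (n + 1 : ℝ)) (by positivity)
  obtain ⟨l, hl, a, φ, hφ, hc⟩ := D.exists_subseq_mod y
  have hz0 : Tendsto z atTop (𝓝 0) :=
    squeeze_zero_norm (fun n => (hlt n).le) tendsto_one_div_add_atTop_nhds_zero_nat
  have hz1 := hz0.comp hφ.tendsto_atTop
  have hc2 := hc.add hz1
  rw [add_zero] at hc2
  have hmem : a ∈ derivedSet {y | D.Bad δ 0 y} := by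
    rw [mem_derivedSet, accPt_iff_nhds]
    intro U hU
    obtain ⟨n, hn1, hn2⟩ := ((hc.eventually hU).and (hc2.eventually hU)).exists
    have b1 : D.Bad δ 0 (y (φ n) - l (φ n)) := by
      rw [sub_eq_add_neg]; exact Bad.add D (hy _) (D.L.neg_mem (hl _))
    have b2 : D.Bad δ 0 (y (φ n) - l (φ n) + z (φ n)) := by
      have := Bad.add D (hz (φ n)) (D.L.neg_mem (hl (φ n)))
      convert this using 1
      abel
    by_cases h : y (φ n) - l (φ n) = a
    · refine ⟨_, ⟨hn2, b2⟩, ?_⟩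
      simp only [Function.comp, h]
      exact fun h' => hne (φ n) (by simpa using h')
    · exact ⟨_, ⟨hn1, b1⟩, h⟩
  rw [hemp] at hmem
  exact hmem

lemma good_stab_of_bad {δ : ℝ} (hδ : 0 < δ) {y : Fin 3 → ℝ} (hy : D.Bad δ 0 y) :
    Good (D.stab y) := by
  obtain ⟨ρ, hρ, hs⟩ := D.exists_separation hδ
  refine D.good_stab_of_separated hρ fun p q l hl h => ?_
  have hinv := D.isInv_bad δ
  refine hs (D.u q * y + l) _ (hinv.add_mem _ (hinv.mul_mem q trivial _ hy) l hl) ?_ h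
  have h1 : D.Bad δ 0 (D.u p * y) := hinv.mul_mem p trivial _ hy
  convert h1 using 1
  ring

lemma eventually_bad_near {δ η : ℝ} (hη : 0 < η) : ∃ s₀ : ℝ, 0 < s₀ ∧
    ∀ s y, |s| < s₀ → D.Bad δ s y → ∃ b, D.Bad δ 0 b ∧ ‖y - b‖ < η := by
  by_contra! hcon
  choose s y hs hy hb using fun n : ℕ => hcon (1 / (n + 1 : ℝ)) (by positivity)
  obtain ⟨l, hl, a, φ, hφ, hc⟩ := D.exists_subseq_mod y
  have hs0 : Tendsto s atTop (𝓝 0) :=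
    squeeze_zero_norm (fun n => (hs n).le) tendsto_one_div_add_atTop_nhds_zero_nat
  have ha : D.Bad δ 0 a := by
    refine D.isClosed_bad.mem_of_tendsto ((hs0.comp hφ.tendsto_atTop).prodMk_nhds hc)
      (Eventually.of_forall fun n => ?_)
    have := Bad.add D (hy (φ n)) (D.L.neg_mem (hl (φ n)))
    rwa [← sub_eq_add_neg] at this
  obtain ⟨n, hn⟩ := (hc.eventually (Metric.ball_mem_nhds a hη)).exists
  have h1 := hb (φ n) _ (Bad.add D ha (hl (φ n)))
  rw [dist_eq_norm] at hn
  have e : y (φ n) - (a + l (φ n)) = y (φ n) - l (φ n) - a := by abel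
  rw [e] at h1
  linarith

lemma u_neg_one_zero : D.u (-1, 0) = ![D.A⁻¹, D.B⁻¹, D.C⁻¹] := by
  ext i; fin_cases i <;> simp [u]

lemma u_one_one : D.u (1, 1) = ![D.B⁻¹, D.C⁻¹, D.A⁻¹] := by
  have hA := D.A_pos.ne'
  have hB := D.B_pos.ne'
  have hC := D.C_pos.ne'
  have h := D.mul_eq_one
  ext i; fin_cases i <;> simp [u] <;> field_simp <;> linarith

/-- Bad points of the sheared form are bad points of the product form. -/
lemma Bad.zero {δ : ℝ} (hδ : 0 < δ) {y : Fin 3 → ℝ} (hy : D.Bad δ 1 y) : D.Bad δ 0 y := by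
  have hA := D.A_pos
  have hB := D.B_pos
  have hC := D.C_pos
  have hA1 := D.one_lt_A
  have hB1 := D.B_lt_one
  have hCB := D.C_lt_B
  obtain ⟨ρ, hρ, hsep⟩ := D.exists_separation hδ
  set Λ : ℝ := ‖D.u (-1, 0)‖ + ‖D.u (1, 1)‖ with hΛ
  have hη : 0 < ρ / (Λ + 1) := by positivity
  obtain ⟨s₀, hs₀, hnear⟩ := D.eventually_bad_near (δ := δ) hη
  set η := ρ / (Λ + 1) with hηd
  obtain ⟨k, hk⟩ := exists_pow_lt_of_lt_one hs₀ ((div_lt_one hA).2 (by linarith : D.C < D.A))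
  set e : ℤ × ℤ := k • (0, 1) with he
  set s : ℝ := 1 * (D.u e 0 / D.u e 1) with hs
  have hs_eq : s = (D.C / D.A) ^ k := by
    simp [hs, he, div_pow, u]
  have hs_pos : 0 < s := by rw [hs_eq]; positivity
  have hy₀ := Bad.u_mul D hy e
  rw [← hs] at hy₀
  set y₀ := D.u e * y with hy₀d
  obtain ⟨b₀, hb₀, hyb⟩ := hnear s y₀ (by rwa [abs_of_pos hs_pos, hs_eq]) hy₀
  have hinv := D.isInv_bad δ
  have key : ∀ g : ℤ × ℤ, D.u g 0 ≤ D.u g 1 → ‖D.u g‖ ≤ Λ → ∀ i, 1 < D.u g i →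
      (y₀ - b₀) i = 0 := by
    intro g hg hgΛ i hi
    have hbd : ∀ n : ℕ, ‖D.u (n • g) * (y₀ - b₀)‖ < η := by
      intro n
      induction n with
      | zero => simpa [u_zero] using hyb
      | succ n ih =>
        have h1 := Bad.u_mul D hy₀ ((n + 1) • g)
        obtain ⟨b, hb, hlt⟩ := hnear _ _ (by
          rw [abs_mul, abs_of_pos hs_pos, abs_of_pos (div_pos (D.u_pos _ _) (D.u_pos _ _))]
          refine (mul_le_of_le_one_right hs_pos.le ?_).trans_lt (by rwa [hs_eq])
          rw [div_le_one (D.u_pos _ _), u_nsmul]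
          exact pow_le_pow_left₀ (D.u_pos _ _).le hg _) h1
        have hb2 : D.Bad δ 0 (D.u ((n + 1) • g) * b₀) := hinv.mul_mem _ trivial _ hb₀
        have hz := hsep b (D.u ((n + 1) • g) * b₀ - b) hb (by rwa [add_sub_cancel]) (by
          have e1 : D.u ((n + 1) • g) * b₀ - b =
              (D.u ((n + 1) • g) * y₀ - b) - D.u g * (D.u (n • g) * (y₀ - b₀)) := by
            rw [succ_nsmul, u_add]; ring
          rw [e1]
          calc _ ≤ ‖D.u ((n + 1) • g) * y₀ - b‖ + ‖D.u g * (D.u (n • g) * (y₀ - b₀))‖ :=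
                norm_sub_le _ _
            _ ≤ ‖D.u ((n + 1) • g) * y₀ - b‖ + Λ * η := by
                gcongr
                refine (norm_mul_le _ _).trans ?_
                gcongr
            _ < η + Λ * η := by gcongr
            _ = (Λ + 1) * η := by ring
            _ = ρ := mul_div_cancel₀ _ (by positivity))
        rw [mul_sub, sub_eq_zero.1 hz]
        exact hlt
    by_contra hne
    obtain ⟨n, hn⟩ := pow_unbounded_of_one_lt (η / |(y₀ - b₀) i|) hi
    have h2 := (norm_le_pi_norm _ i).trans_lt (hbd n)
    rw [div_lt_iff₀ (abs_pos.2 hne)] at hn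
    rw [Pi.mul_apply, u_nsmul, Pi.pow_apply, Real.norm_eq_abs, abs_mul,
      abs_of_pos (pow_pos (D.u_pos _ _) _)] at h2
    linarith
  have hBi : 1 < D.B⁻¹ := (one_lt_inv₀ hB).2 hB1
  have hCi : D.B⁻¹ < D.C⁻¹ := (inv_lt_inv₀ hB hC).2 hCB
  have hAi : D.A⁻¹ < 1 := inv_lt_one_of_one_lt₀ hA1
  have k1 := key (-1, 0) (by simp only [u_neg_one_zero]; simp; linarith)
    (by rw [hΛ]; linarith [norm_nonneg (D.u (1, 1))])
  have k2 := key (1, 1) (by simp only [u_one_one]; simp; linarith)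
    (by rw [hΛ]; linarith [norm_nonneg (D.u (-1, 0))])
  have hd : y₀ = b₀ := by
    refine sub_eq_zero.1 (funext fun i => ?_)
    fin_cases i
    · exact k2 0 (by rw [u_one_one]; exact hBi)
    · exact k1 1 (by rw [u_neg_one_zero]; exact hBi)
    · exact k1 2 (by rw [u_neg_one_zero]; exact hBi.trans hCi)
  have h3 : D.Bad δ 0 (D.u (-e) * y₀) := hinv.mul_mem _ trivial _ (hd ▸ hb₀)
  rwa [hy₀d, ← mul_assoc, u_neg_mul, one_mul] at h3

/-- The sheared form takes arbitrarily small nonzero values on every translate of the lattice. -/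
theorem exists_small_form (y : Fin 3 → ℝ) {δ : ℝ} (hδ : 0 < δ) :
    ∃ l ∈ D.L, 0 < |form 1 (y + l)| ∧ |form 1 (y + l)| < δ := by
  by_contra! hcon
  have hy : D.Bad δ 1 y := fun l hl => by
    by_cases h : form 1 (y + l) = 0
    · exact Or.inl h
    · exact Or.inr (hcon l hl (abs_pos.2 h))
  have hgood := D.good_stab_of_bad hδ (Bad.zero D hδ hy)
  obtain ⟨R, hR, hcov⟩ := D.covering
  obtain ⟨l, hl, hlR⟩ := hcov (![R + 1, -(R + 1), R + 1] - y)
  set w := y + l with hw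
  have hwi := fun i => abs_le.1 ((norm_le_pi_norm _ i).trans hlR)
  have hw0 : 0 < w 0 := by
    have := hwi 0
    simp only [Pi.sub_apply, Matrix.cons_val] at this
    simp only [hw, Pi.add_apply]; linarith
  have hw1 : w 1 < 0 := by
    have := hwi 1
    simp only [Pi.sub_apply, Matrix.cons_val] at this
    simp only [hw, Pi.add_apply]; linarith
  have hw2 : 0 < w 2 := by
    have := hwi 2
    simp only [Pi.sub_apply, Matrix.cons_val] at this
    simp only [hw, Pi.add_apply]; linarith
  set r : ℝ := w 0 / -w 1 with hr
  have hr0 : 0 < r := div_pos hw0 (by linarith)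
  have hη : 0 < δ / (w 1 ^ 2 * w 2 * r) := by
    have : 0 < w 1 ^ 2 := sq_pos_of_neg hw1
    positivity
  obtain ⟨α, β, hind, hlog⟩ := D.log_u_ratio
  obtain ⟨q, hq, hq0, hqη⟩ := hgood.exists_small hind hη
  set η := δ / (w 1 ^ 2 * w 2 * r) with hηd
  set θ := q.1 * α + q.2 * β with hθ
  set k : ℤ := ⌈Real.log r / θ⌉ - 1 with hk
  have hk1 : k * θ < Real.log r := by
    rw [← lt_div_iff₀ hq0, hk]
    push_cast
    linarith [Int.ceil_lt_add_one (Real.log r / θ)]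
  have hk2 : Real.log r - η < k * θ := by
    have : Real.log r / θ ≤ k + 1 := by
      rw [hk]; push_cast; linarith [Int.le_ceil (Real.log r / θ)]
    rw [div_le_iff₀ hq0] at this
    linarith
  set p := k • q with hp
  have hpH := (D.stab y).zsmul_mem hq k
  have hlogp : Real.log (D.u p 1 / D.u p 0) = k * θ := by
    rw [hlog, hp, hθ]; simp; ring
  set τ := D.u p 1 / D.u p 0 with hτ
  have hτ0 : 0 < τ := div_pos (D.u_pos _ _) (D.u_pos _ _)
  have hτr : τ < r := (Real.log_lt_log_iff hτ0 hr0).1 (hlogp ▸ hk1)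
  have hτη : r * (1 - η) < τ := by
    have h1 : r * Real.exp (-η) < τ := by
      rw [← Real.exp_log hr0, ← Real.exp_log hτ0, ← Real.exp_add, hlogp]
      apply Real.exp_lt_exp.2
      linarith
    have h2 := Real.add_one_le_exp (-η)
    have := mul_le_mul_of_nonneg_left h2 hr0.le
    linarith
  have hval : form 1 (D.u p * w) = w 1 ^ 2 * w 2 * (τ - r) := by
    have h := D.u_prod p
    have h0 := (D.u_pos p 0).ne'
    have h1 := hw1.ne
    calc _ = (D.u p 0 * D.u p 1 * D.u p 2) * (w 1 ^ 2 * w 2 * (τ - r)) := by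
          simp only [form, Pi.mul_apply, hτ, hr]
          field_simp
          ring
      _ = _ := by rw [h, one_mul]
  have hmem : D.u p * w = y + ((D.u p * y - y) + D.u p * l) := by
    rw [hw]; ring
  have hc := hy _ (D.L.add_mem (D.mem_stab.1 hpH) (D.u_mul_mem p l hl))
  rw [← hmem, hval] at hc
  have hpos : 0 < w 1 ^ 2 * w 2 := by
    have : 0 < w 1 ^ 2 := sq_pos_of_neg hw1
    positivity
  rcases hc with hc | hc
  · exact absurd hc (mul_ne_zero hpos.ne' (by linarith))
  · rw [abs_mul, abs_of_pos hpos, abs_of_neg (by linarith)] at hc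
    have h5 : w 1 ^ 2 * w 2 * -(τ - r) < w 1 ^ 2 * w 2 * (r * η) :=
      mul_lt_mul_of_pos_left (by linarith) hpos
    have h6 : w 1 ^ 2 * w 2 * (r * η) = δ := by
      have : w 1 ^ 2 * w 2 * r ≠ 0 := (mul_pos hpos hr0).ne'
      rw [hηd, ← mul_assoc, mul_div_cancel₀ _ this]
    linarith

end UnitLattice

lemma exists_cubic_root : ∃ a : ℝ, 0.34 < a ∧ a < 0.35 ∧ a ^ 3 = 3 * a - 1 := by
  have hc : ContinuousOn (fun x : ℝ => x ^ 3 - 3 * x + 1) (Set.Icc 0.34 0.35) := by fun_prop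
  obtain ⟨a, ha, h⟩ := intermediate_value_Ioo' (by norm_num) hc
    (show (0 : ℝ) ∈ _ from ⟨by norm_num, by norm_num⟩)
  exact ⟨a, ha.1, ha.2, by simp only at h; linarith⟩

namespace CubicLattice
open Filter Topology

/-- The power basis matrix of the cubic ring. -/
def basisMatrix (x : Fin 3 → ℝ) : Matrix (Fin 3) (Fin 3) ℝ := Matrix.of fun i j => x i ^ (j : ℕ)

/-- The lattice of values of integer quadratic polynomials. -/
def lattice (x : Fin 3 → ℝ) : AddSubgroup (Fin 3 → ℝ) :=
  ((basisMatrix x).mulVecLin.toAddMonoidHom.comp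
    (AddMonoidHom.pi fun i => (Int.castAddHom ℝ).comp (Pi.evalAddMonoidHom (fun _ => ℤ) i))).range

lemma mem_lattice {x l : Fin 3 → ℝ} :
    l ∈ lattice x ↔ ∃ n : Fin 3 → ℤ, basisMatrix x *ᵥ (fun i => (n i : ℝ)) = l := Iff.rfl

lemma basisMatrix_mulVec (x v : Fin 3 → ℝ) :
    basisMatrix x *ᵥ v = fun i => v 0 + x i * v 1 + x i ^ 2 * v 2 := by
  ext i
  simp [basisMatrix, Matrix.mulVec, dotProduct, Fin.sum_univ_three]

lemma det_basisMatrix (x : Fin 3 → ℝ) :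
    (basisMatrix x).det = (x 1 - x 0) * (x 2 - x 0) * (x 2 - x 1) := by
  rw [Matrix.det_fin_three]
  simp [basisMatrix]
  ring

lemma mul_mem_lattice {x : Fin 3 → ℝ} (hx : ∀ i, x i ^ 3 = 3 * x i - 1) {l : Fin 3 → ℝ}
    (hl : l ∈ lattice x) : x * l ∈ lattice x := by
  obtain ⟨n, rfl⟩ := mem_lattice.1 hl
  refine mem_lattice.2 ⟨![-n 2, n 0 + 3 * n 2, n 1], ?_⟩
  rw [basisMatrix_mulVec, basisMatrix_mulVec]
  ext i
  simp
  linear_combination (-(n 2 : ℝ)) * hx i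

lemma sq_sub_two_mul_mem_lattice {x : Fin 3 → ℝ} (hx : ∀ i, x i ^ 3 = 3 * x i - 1) {l : Fin 3 → ℝ}
    (hl : l ∈ lattice x) : (x ^ 2 - 2) * l ∈ lattice x := by
  have := (lattice x).sub_mem (mul_mem_lattice hx (mul_mem_lattice hx hl))
    ((lattice x).nsmul_mem hl 2)
  convert this using 1
  simp only [nsmul_eq_mul]
  push_cast
  ring

lemma exists_covering {x : Fin 3 → ℝ} (hd : (basisMatrix x).det ≠ 0) :
    ∃ R : ℝ, 0 < R ∧ ∀ y, ∃ l ∈ lattice x, ‖y - l‖ ≤ R := by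
  obtain ⟨R, hR⟩ := ((isCompact_Icc (a := (0 : Fin 3 → ℝ)) (b := 1)).image
    (continuous_const.matrix_mulVec continuous_id : Continuous (basisMatrix x *ᵥ ·))).isBounded.exists_norm_le
  refine ⟨max R 1, by positivity, fun y => ?_⟩
  set v := (basisMatrix x)⁻¹ *ᵥ y with hv
  refine ⟨_, mem_lattice.2 ⟨fun i => ⌊v i⌋, rfl⟩, le_max_of_le_left (hR _ ⟨v - fun i => (⌊v i⌋ : ℝ),
    ⟨fun i => ?_, fun i => ?_⟩, ?_⟩)⟩
  · simp
  · simpa using (Int.fract_lt_one (v i)).le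
  · simp only [Matrix.mulVec_sub]
    rw [hv, Matrix.mulVec_mulVec, Matrix.mul_nonsing_inv _ (isUnit_iff_ne_zero.2 hd),
      Matrix.one_mulVec]

lemma exists_discrete {x : Fin 3 → ℝ} (hd : (basisMatrix x).det ≠ 0) :
    ∃ ρ : ℝ, 0 < ρ ∧ ∀ l ∈ lattice x, ‖l‖ < ρ → l = 0 := by
  have hc : Continuous fun l => (basisMatrix x)⁻¹ *ᵥ l := continuous_const.matrix_mulVec continuous_id
  obtain ⟨ρ, hρ, h⟩ := Metric.continuousAt_iff.1 (hc.continuousAt (x := 0)) 1 one_pos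
  refine ⟨ρ, hρ, fun l hl hlt => ?_⟩
  have h1 := h (x := l) (by rwa [dist_zero_right])
  obtain ⟨n, rfl⟩ := mem_lattice.1 hl
  rw [Matrix.mulVec_mulVec, Matrix.nonsing_inv_mul _ (isUnit_iff_ne_zero.2 hd), Matrix.one_mulVec,
    Matrix.mulVec_zero, dist_zero_right] at h1
  have : (fun i => (n i : ℝ)) = 0 := by
    ext i
    have h2 := (norm_le_pi_norm _ i).trans_lt h1
    simp only [Real.norm_eq_abs] at h2
    have h3 : |n i| < 1 := by exact_mod_cast h2
    simp [Int.abs_lt_one_iff.1 h3]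
  rw [this, Matrix.mulVec_zero]

/-- The conjugates of a root of `X ^ 3 - 3 * X + 1`. -/
def conj (a : ℝ) : Fin 3 → ℝ := ![a, 2 - a - a ^ 2, a ^ 2 - 2]

lemma conj_pow {a : ℝ} (ha : a ^ 3 = 3 * a - 1) (i : Fin 3) : conj a i ^ 3 = 3 * conj a i - 1 := by
  have h : ∀ x : ℝ, x ^ 3 = 3 * x - 1 → (x ^ 2 - 2) ^ 3 = 3 * (x ^ 2 - 2) - 1 := fun x hx => by
    linear_combination (x ^ 3 - 3 * x - 1) * hx
  have h1 : (a ^ 2 - 2) ^ 2 - 2 = 2 - a - a ^ 2 := by linear_combination a * ha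
  have h2 := h _ (h _ ha)
  rw [h1] at h2
  fin_cases i
  · exact ha
  · exact h2
  · exact h _ ha

lemma det_conj_pos {a : ℝ} (h1 : 0.34 < a) (h2 : a < 0.35) : 0 < (basisMatrix (conj a)).det := by
  rw [det_basisMatrix]
  simp only [conj, Matrix.cons_val]
  refine mul_pos_of_neg_of_neg (mul_neg_of_pos_of_neg ?_ ?_) ?_ <;> nlinarith

lemma bounds {a : ℝ} (h1 : 0.34 < a) (h2 : a < 0.35) : (3 - conj a 1 ^ 2) ^ 2 < 1 ∧
    (3 - conj a 2 ^ 2) ^ 2 < (3 - conj a 1 ^ 2) ^ 2 ∧ 3 - conj a 2 ^ 2 < 0 := by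
  simp only [conj, Matrix.cons_val]
  have hb1 : 1.5 < 2 - a - a ^ 2 := by nlinarith
  have hb2 : 2 - a - a ^ 2 < 1.545 := by nlinarith
  have hc1 : -1.89 < a ^ 2 - 2 := by nlinarith
  have hc2 : a ^ 2 - 2 < -1.87 := by nlinarith
  set b := 2 - a - a ^ 2
  set c := a ^ 2 - 2
  have hB1 : 0.6 < 3 - b ^ 2 := by nlinarith
  have hB2 : 3 - b ^ 2 < 0.8 := by nlinarith
  have hC1 : -0.6 < 3 - c ^ 2 := by nlinarith
  have hC2 : 3 - c ^ 2 < 0 := by nlinarith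
  refine ⟨by nlinarith, ?_, hC2⟩
  exact sq_lt_sq.2 (by rw [abs_of_neg hC2, abs_of_pos (by linarith)]; linarith)

/-- The ring of integers of the cubic field generated by `X ^ 3 - 3 * X + 1`. -/
noncomputable def unitLattice {a : ℝ} (h1 : 0.34 < a) (h2 : a < 0.35) (ha : a ^ 3 = 3 * a - 1) :
    UnitLattice :=
  have hx := conj_pow ha
  have hd := (det_conj_pos h1 h2).ne'
  have hinv : ∀ i, (3 - conj a i ^ 2) ^ 2 * conj a i ^ 2 = 1 := fun i => by
    have : (3 - conj a i ^ 2) * conj a i = 1 := by linear_combination -hx i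
    rw [← mul_pow, this, one_pow]
  have hinv' : ∀ i, ((3 - conj a i ^ 2) ^ 2)⁻¹ = conj a i ^ 2 := fun i =>
    _root_.inv_eq_of_mul_eq_one_right (hinv i)
  have hsub : ∀ l ∈ lattice (conj a), (3 - conj a ^ 2) * l ∈ lattice (conj a) := fun l hl => by
    have := (lattice (conj a)).sub_mem hl (sq_sub_two_mul_mem_lattice hx hl)
    convert this using 1
    ring
  have hc0 : conj a 0 ^ 2 - 2 = conj a 2 := rfl
  have hc1 : conj a 1 ^ 2 - 2 = conj a 0 := by
    simp only [conj, Matrix.cons_val]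
    linear_combination (a + 2) * ha
  have hc2 : conj a 2 ^ 2 - 2 = conj a 1 := by
    simp only [conj, Matrix.cons_val]
    linear_combination a * ha
  have hsub' : ∀ l ∈ lattice (conj a), (3 - (conj a ^ 2 - 2) ^ 2) * l ∈ lattice (conj a) :=
    fun l hl => by
    have := (lattice (conj a)).sub_mem ((lattice (conj a)).nsmul_mem hl 3)
      (sq_sub_two_mul_mem_lattice hx (sq_sub_two_mul_mem_lattice hx hl))
    convert this using 1
    simp only [nsmul_eq_mul]
    push_cast
    ring
  { L := lattice (conj a)
    A := (3 - conj a 0 ^ 2) ^ 2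
    B := (3 - conj a 1 ^ 2) ^ 2
    C := (3 - conj a 2 ^ 2) ^ 2
    one_mem := mem_lattice.2 ⟨![1, 0, 0], by rw [basisMatrix_mulVec]; ext i; simp⟩
    covering := exists_covering hd
    discrete := exists_discrete hd
    one_lt_A := by
      simp only [conj, Matrix.cons_val]
      nlinarith
    B_lt_one := (bounds h1 h2).1
    C_lt_B := (bounds h1 h2).2.1
    C_pos := sq_pos_of_neg (bounds h1 h2).2.2
    mul_eq_one := by
      have h : conj a 0 * conj a 1 * conj a 2 = -1 := by
        simp only [conj, Matrix.cons_val]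
        linear_combination (-a ^ 2 - a + 1) * ha
      have h' : (conj a 0 ^ 2) * (conj a 1 ^ 2) * (conj a 2 ^ 2) = 1 := by
        rw [← mul_pow, ← mul_pow, h]; norm_num
      calc _ = ((3 - conj a 0 ^ 2) ^ 2 * conj a 0 ^ 2) * ((3 - conj a 1 ^ 2) ^ 2 * conj a 1 ^ 2) *
            ((3 - conj a 2 ^ 2) ^ 2 * conj a 2 ^ 2) := by
              linear_combination
                (-(3 - conj a 0 ^ 2) ^ 2 * (3 - conj a 1 ^ 2) ^ 2 * (3 - conj a 2 ^ 2) ^ 2) * h'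
        _ = 1 := by rw [hinv, hinv, hinv]; norm_num
    mul_mem₁ := fun l hl => by
      have : ![(3 - conj a 0 ^ 2) ^ 2, (3 - conj a 1 ^ 2) ^ 2, (3 - conj a 2 ^ 2) ^ 2] * l =
          (3 - conj a ^ 2) * ((3 - conj a ^ 2) * l) := by
        ext i; fin_cases i <;> simp <;> ring
      rw [this]
      exact hsub _ (hsub _ hl)
    inv_mul_mem₁ := fun l hl => by
      rw [hinv', hinv', hinv']
      have : ![conj a 0 ^ 2, conj a 1 ^ 2, conj a 2 ^ 2] * l = conj a * (conj a * l) := by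
        ext i; fin_cases i <;> simp <;> ring
      rw [this]
      exact mul_mem_lattice hx (mul_mem_lattice hx hl)
    mul_mem₂ := fun l hl => by
      have : ![(3 - conj a 2 ^ 2) ^ 2, (3 - conj a 0 ^ 2) ^ 2, (3 - conj a 1 ^ 2) ^ 2] * l =
          (3 - (conj a ^ 2 - 2) ^ 2) * ((3 - (conj a ^ 2 - 2) ^ 2) * l) := by
        ext i; fin_cases i <;> simp [hc0, hc1, hc2] <;> ring
      rw [this]
      exact hsub' _ (hsub' _ hl)
    inv_mul_mem₂ := fun l hl => by
      rw [hinv', hinv', hinv']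
      have : ![conj a 2 ^ 2, conj a 0 ^ 2, conj a 1 ^ 2] * l =
          (conj a ^ 2 - 2) * ((conj a ^ 2 - 2) * l) := by
        ext i; fin_cases i <;> simp [hc0, hc1, hc2] <;> ring
      rw [this]
      exact sq_sub_two_mul_mem_lattice hx (sq_sub_two_mul_mem_lattice hx hl) }

/-- There is a unimodular lattice each of whose translates contains points with arbitrarily small
nonzero product of coordinates. -/
theorem exists_specialLinearGroup : ∃ g : Matrix.SpecialLinearGroup (Fin 3) ℝ, ∀ (y : Fin 3 → ℝ) (δ : ℝ),
    0 < δ → ∃ n : Fin 3 → ℤ,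
      0 < |∏ i, ((g : Matrix (Fin 3) (Fin 3) ℝ) *ᵥ (fun i => (n i : ℝ)) + y) i| ∧
      |∏ i, ((g : Matrix (Fin 3) (Fin 3) ℝ) *ᵥ (fun i => (n i : ℝ)) + y) i| < δ := by
  obtain ⟨a, h1, h2, ha⟩ := exists_cubic_root
  set G := basisMatrix (conj a) with hG
  have hd : 0 < G.det := det_conj_pos h1 h2
  set S : Matrix (Fin 3) (Fin 3) ℝ := !![1, 1, 0; 0, 1, 0; 0, 0, 1] with hS
  have hSdet : S.det = 1 := by simp [hS, Matrix.det_fin_three]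
  obtain ⟨c, hc, hc3⟩ : ∃ c : ℝ, 0 < c ∧ c ^ 3 = G.det⁻¹ :=
    ⟨G.det⁻¹ ^ ((3 : ℕ) : ℝ)⁻¹, by positivity, Real.rpow_inv_natCast_pow (by positivity) (by norm_num)⟩
  refine ⟨⟨c • (S * G), ?_⟩, fun y δ hδ => ?_⟩
  · rw [Matrix.det_smul, Matrix.det_mul, hSdet, Fintype.card_fin, hc3, one_mul,
      inv_mul_cancel₀ hd.ne']
  set z : Fin 3 → ℝ := ![c⁻¹ * (y 0 - y 1), c⁻¹ * y 1, c⁻¹ * y 2] with hz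
  obtain ⟨l, hl, hl1, hl2⟩ := (unitLattice h1 h2 ha).exists_small_form z
    (div_pos hδ (pow_pos hc 3))
  obtain ⟨n, rfl⟩ := mem_lattice.1 hl
  refine ⟨n, ?_⟩
  have e : ∏ i, ((c • (S * G)) *ᵥ (fun i => (n i : ℝ)) + y) i =
      c ^ 3 * UnitLattice.form 1 (z + G *ᵥ (fun i => (n i : ℝ))) := by
    rw [Matrix.smul_mulVec, ← Matrix.mulVec_mulVec]
    set x := G *ᵥ (fun i => (n i : ℝ))
    have hy : y = c • ![z 0 + z 1, z 1, z 2] := by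
      ext i
      fin_cases i <;> simp [hz] <;> field_simp
      ring
    rw [hy]
    simp [Fin.prod_univ_three, hS, UnitLattice.form, dotProduct, Fin.sum_univ_three]
    ring
  simp only [e, abs_mul, abs_of_pos (pow_pos hc 3)]
  rw [lt_div_iff₀' (pow_pos hc 3)] at hl2
  exact ⟨mul_pos (pow_pos hc 3) hl1, hl2⟩

end CubicLattice

namespace SL3R
open Filter Topology Pointwise

instance : IsTopologicalGroup SL3R := Matrix.SpecialLinearGroup.topologicalGroup

lemma continuous_coe : Continuous fun g : SL3R => (g : Matrix (Fin 3) (Fin 3) ℝ) :=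
  continuous_induced_dom

lemma continuous_of_coe {X : Type*} [TopologicalSpace X] {f : X → SL3R}
    (hf : ∀ i j, Continuous fun x => (f x : Matrix (Fin 3) (Fin 3) ℝ) i j) : Continuous f :=
  continuous_induced_rng.2 (continuous_matrix hf)

lemma continuous_entry (i j : Fin 3) :
    Continuous fun g : SL3R => (g : Matrix (Fin 3) (Fin 3) ℝ) i j :=
  continuous_coe.matrix_elem i j

lemma mem_SL3Z {g : SL3R} :
    g ∈ SL3Z ↔ ∀ i j, (g : Matrix (Fin 3) (Fin 3) ℝ) i j ∈ Set.range ((↑) : ℤ → ℝ) := by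
  constructor
  · rintro ⟨γ, rfl⟩ i j
    exact ⟨(γ : Matrix (Fin 3) (Fin 3) ℤ) i j, rfl⟩
  · intro h
    choose G hG using h
    have hmap : (Int.castRingHom ℝ).mapMatrix (Matrix.of G) = (g : Matrix (Fin 3) (Fin 3) ℝ) := by
      ext i j
      exact hG i j
    have hdet : (Matrix.of G).det = 1 := by
      have := RingHom.map_det (Int.castRingHom ℝ) (Matrix.of G)
      rw [hmap, g.2] at this
      have h1 : ((Matrix.of G).det : ℝ) = 1 := this.symm ▸ rfl
      exact_mod_cast h1
    exact ⟨⟨Matrix.of G, hdet⟩, Subtype.ext hmap⟩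

lemma isClosed_SL3Z : IsClosed (SL3Z : Set SL3R) := by
  have : (SL3Z : Set SL3R) = ⋂ i, ⋂ j,
      {g : SL3R | (g : Matrix (Fin 3) (Fin 3) ℝ) i j ∈ Set.range ((↑) : ℤ → ℝ)} := by
    ext g
    simp only [SetLike.mem_coe, mem_SL3Z, Set.mem_iInter, Set.mem_ofPred_eq]
  rw [this]
  exact isClosed_iInter fun i => isClosed_iInter fun j =>
    Int.isClosedEmbedding_coe_real.isClosed_range.preimage (continuous_entry i j)

lemma countable_SL3Z : (SL3Z : Set SL3R).Countable := by
  have h1 : Countable (Matrix (Fin 3) (Fin 3) ℤ) :=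
    inferInstanceAs (Countable (Fin 3 → Fin 3 → ℤ))
  have h2 : Countable (Matrix.SpecialLinearGroup (Fin 3) ℤ) := Subtype.countable
  exact Set.countable_range (Matrix.SpecialLinearGroup.map (n := Fin 3) (Int.castRingHom ℝ))

lemma continuous_aMat3 : Continuous aMat3 := by
  refine continuous_of_coe fun i j => ?_
  fin_cases i <;> fin_cases j <;> simp [aMat3, Matrix.diagonal] <;> fun_prop

/-- The lower triangular unipotent matrices with one free entry. -/
def lower (s : ℝ) : SL3R := ⟨!![1, 0, 0; 0, 1, 0; s, 0, 1], by simp [Matrix.det_fin_three]⟩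

lemma continuous_lower : Continuous lower := by
  refine continuous_of_coe fun i j => ?_
  fin_cases i <;> fin_cases j <;> simp [lower] <;> fun_prop

lemma coe_aMat3_mul (t : ℝ) (X : SL3R) : ((aMat3 t * X : SL3R) : Matrix (Fin 3) (Fin 3) ℝ) =
    Matrix.diagonal ![Real.exp t, Real.exp t, Real.exp (-(2 * t))] * X := rfl

/-- The translates of a point by the lower unipotents lie on distinct orbits of the diagonal
group. -/
lemma eq_of_lower_eq {s s' t t' : ℝ} {X : SL3R} (h : lower s = aMat3 t * X)
    (h' : lower s' = aMat3 t' * X) : s = s' := by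
  have key : ∀ s t : ℝ, lower s = aMat3 t * X →
      s = Real.exp (-(2 * t)) * X.1 2 0 ∧ 1 = Real.exp (-(2 * t)) * X.1 2 2 := by
    intro s t h
    constructor
    · have := congrArg (fun g : SL3R => (g : Matrix (Fin 3) (Fin 3) ℝ) 2 0) h
      simp only [coe_aMat3_mul, Matrix.diagonal_mul] at this
      simpa [lower] using this
    · have := congrArg (fun g : SL3R => (g : Matrix (Fin 3) (Fin 3) ℝ) 2 2) h
      simp only [coe_aMat3_mul, Matrix.diagonal_mul] at this
      simpa [lower] using this
  obtain ⟨h1, h2⟩ := key s t h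
  obtain ⟨h3, h4⟩ := key s' t' h'
  calc s = s * (Real.exp (-(2 * t')) * X.1 2 2) := by rw [← h4, mul_one]
    _ = Real.exp (-(2 * t)) * X.1 2 2 * (Real.exp (-(2 * t')) * X.1 2 0) := by rw [h1]; ring
    _ = s' := by rw [← h2, one_mul, ← h3]

/-- A dense positive orbit visits every open set at arbitrarily large times. -/
theorem exists_mem_of_dense {v : Fin 2 → ℝ}
    (hdense : Dense {x : SL3R ⧸ SL3Z | ∃ t : ℝ, 0 < t ∧
      x = QuotientGroup.mk (aMat3 t * uMat3 v)}) {W : Set SL3R} (hW : IsOpen W)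
    (hne : W.Nonempty) (T : ℝ) : ∃ t, T < t ∧ ∃ γ ∈ SL3Z, aMat3 t * uMat3 v * γ ∈ W := by
  by_contra! hcon
  set K : Set SL3R := (fun t => aMat3 t * uMat3 v) '' Set.Icc 0 T with hK
  have hKc : IsCompact K := isCompact_Icc.image (continuous_aMat3.mul continuous_const)
  have hcl : IsClosed (K * (SL3Z : Set SL3R)) := isClosed_SL3Z.mul_left_of_isCompact hKc
  have hsub : W ⊆ K * (SL3Z : Set SL3R) := by
    intro g hg
    by_contra hgK
    set V := W ∩ (K * (SL3Z : Set SL3R))ᶜ with hV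
    have hVo : IsOpen V := hW.inter hcl.isOpen_compl
    obtain ⟨x, ⟨w, hw, hwx⟩, t, ht, hx⟩ := hdense.inter_open_nonempty _
      (QuotientGroup.isOpenMap_coe (N := SL3Z) V hVo) ⟨_, g, ⟨hg, hgK⟩, rfl⟩
    rw [hx] at hwx
    have hγ := QuotientGroup.eq.1 hwx.symm
    have hprod : aMat3 t * uMat3 v * ((aMat3 t * uMat3 v)⁻¹ * w) = w := mul_inv_cancel_left _ _
    rcases lt_or_ge T t with h | h
    · exact hcon t h _ hγ (by rw [hprod]; exact hw.1)
    · exact hw.2 (Set.mem_mul.2 ⟨_, ⟨t, ⟨ht.le, h⟩, rfl⟩, _, hγ, hprod⟩)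
  obtain ⟨g, hg⟩ := hne
  have hU : IsOpen {s : ℝ | lower s * g ∈ W} :=
    hW.preimage (continuous_lower.mul continuous_const)
  have h0 : (0 : ℝ) ∈ {s : ℝ | lower s * g ∈ W} := by
    have : lower 0 = 1 := by
      ext i j
      fin_cases i <;> fin_cases j <;> simp [lower]
    simpa [this] using hg
  have hmem : ∀ s ∈ {s : ℝ | lower s * g ∈ W}, ∃ γ ∈ SL3Z, ∃ t,
      lower s = aMat3 t * (uMat3 v * γ * g⁻¹) := by
    intro s hs
    obtain ⟨_, ⟨t, -, rfl⟩, γ, hγ, h⟩ := Set.mem_mul.1 (hsub hs)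
    refine ⟨γ, hγ, t, ?_⟩
    rw [eq_mul_inv_iff_mul_eq.2 h.symm]
    simp only [mul_assoc]
  choose! γ hγ t ht using hmem
  have hcount : {s : ℝ | lower s * g ∈ W}.Countable := by
    refine Set.MapsTo.countable_of_injOn hγ (fun s hs s' hs' h => ?_) countable_SL3Z
    have h1 := ht s hs
    rw [h] at h1
    exact eq_of_lower_eq h1 (ht s' hs')
  obtain ⟨s, hs, hs'⟩ := (hcount.dense_compl ℝ).inter_open_nonempty _ hU ⟨0, h0⟩
  exact hs' hs

/-- Near some lattice, every translate has points with small product of coordinates, whose last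
coordinate and product of the first two coordinates are bounded away from zero. -/
theorem exists_robust : ∃ g : SL3R, ∀ δ > 0, ∃ c > 0, ∀ᶠ h : SL3R in 𝓝 g,
    ∀ y : Fin 3 → ℝ, ∃ n : Fin 3 → ℤ, ∃ w : Fin 3 → ℝ, w = h.1 *ᵥ (fun i => (n i : ℝ)) + y ∧
      |∏ i, w i| < δ ∧ c < |w 2| ∧ c < |w 0 * w 1| := by
  obtain ⟨g, hg⟩ := CubicLattice.exists_specialLinearGroup
  refine ⟨g, fun δ hδ => ?_⟩
  have hloc := (isCompact_Icc (a := (0 : Fin 3 → ℝ)) (b := 1)).eventually_forall_of_forall_eventually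
    (x₀ := ((g : Matrix (Fin 3) (Fin 3) ℝ), (0 : ℝ)))
    (P := fun p f => ∃ n : Fin 3 → ℤ, ∃ w : Fin 3 → ℝ, w = p.1 *ᵥ ((fun i => (n i : ℝ)) + f) ∧
      |∏ i, w i| < δ ∧ p.2 < |w 2| ∧ p.2 < |w 0 * w 1|) (by
    intro f _
    obtain ⟨n, hn1, hn2⟩ := hg (g.1 *ᵥ f) δ hδ
    rw [← Matrix.mulVec_add] at hn1 hn2
    have hw : Continuous fun z : (Matrix (Fin 3) (Fin 3) ℝ × ℝ) × (Fin 3 → ℝ) =>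
        z.1.1 *ᵥ ((fun i => (n i : ℝ)) + z.2) :=
      (continuous_fst.comp continuous_fst).matrix_mulVec (continuous_const.add continuous_snd)
    have hwi := continuous_pi_iff.1 hw
    have hc : Continuous fun z : (Matrix (Fin 3) (Fin 3) ℝ × ℝ) × (Fin 3 → ℝ) => z.1.2 :=
      continuous_snd.comp continuous_fst
    have hne := Finset.prod_ne_zero_iff.1 (abs_pos.1 hn1)
    have e1 := (isOpen_lt (continuous_finsetProd Finset.univ fun i _ => hwi i).abs
      (continuous_const (y := δ))).mem_nhds
      (x := ((g.1, 0), f)) hn2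
    have e2 := (isOpen_lt hc (hwi 2).abs).mem_nhds
      (x := ((g.1, 0), f)) (abs_pos.2 (hne 2 (Finset.mem_univ _)))
    have e3 := (isOpen_lt hc ((hwi 0).mul (hwi 1)).abs).mem_nhds
      (x := ((g.1, 0), f)) (abs_pos.2 (mul_ne_zero (hne 0 (Finset.mem_univ _))
        (hne 1 (Finset.mem_univ _))))
    filter_upwards [e1, e2, e3] with z h1 h2 h3
    exact ⟨n, _, rfl, h1, h2, h3⟩)
  rw [nhds_prod_eq] at hloc
  obtain ⟨pa, ha, pb, hb, hab⟩ := eventually_prod_iff.1 hloc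
  obtain ⟨c, hcb, hc0⟩ := ((hb.filter_mono nhdsWithin_le_nhds).and
    (self_mem_nhdsWithin : Set.Ioi (0 : ℝ) ∈ 𝓝[>] 0)).exists
  refine ⟨c, hc0, ?_⟩
  filter_upwards [continuous_coe.continuousAt.eventually ha] with h hh y
  set x : Fin 3 → ℝ := (h⁻¹).1 *ᵥ y with hx
  have hy : h.1 *ᵥ x = y := by
    have h1 : h.1 * (h⁻¹).1 = 1 := congrArg Subtype.val (mul_inv_cancel h)
    rw [hx, Matrix.mulVec_mulVec, h1, Matrix.one_mulVec]
  obtain ⟨n, w, hw, h1⟩ := hab hh hcb (fun i => Int.fract (x i))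
    ⟨fun i => Int.fract_nonneg _, fun i => (Int.fract_lt_one _).le⟩
  refine ⟨fun i => n i - ⌊x i⌋, w, ?_, h1⟩
  rw [hw, ← hy, ← Matrix.mulVec_add]
  congr 1
  ext i
  simp only [Pi.add_apply, Int.fract]
  push_cast
  ring

lemma coe_mul_mulVec (g h : SL3R) (x : Fin 3 → ℝ) : (g * h).1 *ᵥ x = g.1 *ᵥ (h.1 *ᵥ x) :=
  (Matrix.mulVec_mulVec _ _ _).symm

lemma inv_mulVec_mulVec (g : SL3R) (x : Fin 3 → ℝ) : (g⁻¹).1 *ᵥ (g.1 *ᵥ x) = x := by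
  rw [← coe_mul_mulVec, inv_mul_cancel]
  exact Matrix.one_mulVec x

lemma aMat3_mulVec (t : ℝ) (x : Fin 3 → ℝ) :
    (aMat3 t).1 *ᵥ x = ![Real.exp t * x 0, Real.exp t * x 1, Real.exp (-(2 * t)) * x 2] := by
  ext i
  fin_cases i <;> simp [aMat3, Matrix.mulVec_diagonal]

lemma uMat3_mulVec (v : Fin 2 → ℝ) (x : Fin 3 → ℝ) :
    (uMat3 v).1 *ᵥ x = ![x 0 - v 0 * x 2, x 1 - v 1 * x 2, x 2] := by
  ext i
  fin_cases i <;> simp [uMat3, Matrix.mulVec, dotProduct, Fin.sum_univ_three] <;> ring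

lemma exists_int_mulVec {γ : SL3R} (hγ : γ ∈ SL3Z) (n : Fin 3 → ℤ) :
    ∃ m : Fin 3 → ℤ, γ.1 *ᵥ (fun i => (n i : ℝ)) = fun i => (m i : ℝ) := by
  choose G hG using mem_SL3Z.1 hγ
  refine ⟨fun i => ∑ j, G i j * n j, ?_⟩
  ext i
  simp only [Matrix.mulVec, dotProduct]
  push_cast
  exact Finset.sum_congr rfl fun j _ => by rw [hG]

lemma orbit_mulVec (t : ℝ) (v : Fin 2 → ℝ) {γ : SL3R} {n m : Fin 3 → ℤ}
    (h : γ.1 *ᵥ (fun i => (n i : ℝ)) = fun i => (m i : ℝ)) :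
    (aMat3 t * uMat3 v * γ).1 *ᵥ (fun i => (n i : ℝ)) =
      ![Real.exp t * (m 0 - v 0 * m 2), Real.exp t * (m 1 - v 1 * m 2),
        Real.exp (-(2 * t)) * m 2] := by
  rw [coe_mul_mulVec, coe_mul_mulVec, h, uMat3_mulVec, aMat3_mulVec]
  simp

/-- The inverse transpose. -/
def dual (g : SL3R) : SL3R := Matrix.SpecialLinearGroup.transpose g⁻¹

lemma continuous_dual : Continuous dual :=
  continuous_of_coe fun i j => (continuous_entry j i).comp continuous_inv

lemma coe_dual (g : SL3R) : (dual g).1 = (g⁻¹).1ᵀ := rfl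

lemma dual_mul (g h : SL3R) : dual (g * h) = dual g * dual h := by
  refine Subtype.ext ?_
  change ((g * h)⁻¹).1ᵀ = (g⁻¹).1ᵀ * (h⁻¹).1ᵀ
  rw [_root_.mul_inv_rev, ← Matrix.transpose_mul]
  rfl

lemma dual_dual (g : SL3R) : dual (dual g) = g := by
  have h1 : (dual g)⁻¹ = Matrix.SpecialLinearGroup.transpose g := by
    refine inv_eq_of_mul_eq_one_right (Subtype.ext ?_)
    change (g⁻¹).1ᵀ * g.1ᵀ = 1
    rw [← Matrix.transpose_mul, show g.1 * (g⁻¹).1 = 1 from congrArg Subtype.val (mul_inv_cancel g),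
      Matrix.transpose_one]
  refine Subtype.ext ?_
  rw [coe_dual, h1]
  exact Matrix.transpose_transpose _

lemma dual_mem {γ : SL3R} (hγ : γ ∈ SL3Z) : dual γ ∈ SL3Z :=
  mem_SL3Z.2 fun i j => mem_SL3Z.1 (SL3Z.inv_mem hγ) j i

lemma dual_aMat3 (t : ℝ) : dual (aMat3 t) = aMat3 (-t) := by
  have h : (aMat3 t)⁻¹ = aMat3 (-t) := by
    refine inv_eq_of_mul_eq_one_right (Subtype.ext ?_)
    change (aMat3 t).1 * (aMat3 (-t)).1 = 1
    simp only [aMat3]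
    rw [Matrix.diagonal_mul_diagonal, ← Matrix.diagonal_one]
    congr 1
    ext i
    fin_cases i <;> simp [← Real.exp_add]
  refine Subtype.ext ?_
  rw [coe_dual, h]
  exact Matrix.diagonal_transpose _

lemma dual_uMat3_mulVec (v : Fin 2 → ℝ) (x : Fin 3 → ℝ) :
    (dual (uMat3 v)).1 *ᵥ x = ![x 0, x 1, v 0 * x 0 + v 1 * x 1 + x 2] := by
  have h : (uMat3 v)⁻¹ = uMat3 (-v) := by
    refine inv_eq_of_mul_eq_one_right (Subtype.ext ?_)
    change (uMat3 v).1 * (uMat3 (-v)).1 = 1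
    ext i j
    fin_cases i <;> fin_cases j <;> simp [uMat3, Matrix.mul_apply, Fin.sum_univ_three]
  rw [coe_dual, h]
  ext i
  fin_cases i <;> simp [uMat3, Matrix.mulVec, dotProduct, Fin.sum_univ_three]

lemma intDist_le (x : ℝ) (m : ℤ) : intDist x ≤ |x - m| := round_le x m

lemma intDist_nonneg (x : ℝ) : 0 ≤ intDist x := abs_nonneg _

lemma lt_exp_mul {M c t : ℝ} (hM : 0 < M) (hc : 0 < c) (ht : Real.log (M / c) / 2 < t) :
    M < Real.exp (2 * t) * c := by
  rw [← div_lt_iff₀ hc, ← Real.exp_log (div_pos hM hc)]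
  exact Real.exp_lt_exp.2 (by linarith)

theorem propCSecond_of_dense {v : Fin 2 → ℝ}
    (hdense : Dense {x : SL3R ⧸ SL3Z | ∃ t : ℝ, 0 < t ∧
      x = QuotientGroup.mk (aMat3 t * uMat3 v)}) : PropCSecond v := by
  intro γ₁ γ₂ δ M hδ hM
  obtain ⟨g, hg⟩ := exists_robust
  obtain ⟨c, hc, hloc⟩ := hg δ hδ
  obtain ⟨U, hU, hUo, hgU⟩ := eventually_nhds_iff.1 hloc
  obtain ⟨t, ht, γ, hγ, hmem⟩ := exists_mem_of_dense hdense hUo ⟨g, hgU⟩ (Real.log (M / c) / 2)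
  obtain ⟨n, w, hw, h1, h2, -⟩ := hU _ hmem ![Real.exp t * γ₁, Real.exp t * γ₂, 0]
  obtain ⟨m, hm⟩ := exists_int_mulVec hγ n
  rw [orbit_mulVec t v hm] at hw
  have hE : Real.exp (2 * t) * Real.exp (-(2 * t)) = 1 := by
    rw [← Real.exp_add, add_neg_cancel, Real.exp_zero]
  have hE' : Real.exp t * Real.exp t = Real.exp (2 * t) := by rw [← Real.exp_add, two_mul]
  have hw2 : w 2 = Real.exp (-(2 * t)) * m 2 := by simp [hw]
  refine ⟨m 2, ?_, ?_⟩
  · have h3 := lt_exp_mul hM hc ht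
    rw [hw2, abs_mul, abs_of_pos (Real.exp_pos _)] at h2
    have h4 := mul_lt_mul_of_pos_left h2 (Real.exp_pos (2 * t))
    rw [← mul_assoc, hE, one_mul] at h4
    push_cast
    linarith
  · have hprod : ∏ i, w i = m 2 * (m 2 * v 0 - γ₁ - m 0) * (m 2 * v 1 - γ₂ - m 1) := by
      rw [Fin.prod_univ_three, hw]
      simp only [Pi.add_apply, Matrix.cons_val]
      rw [← hE'] at hE
      linear_combination (m 2 * (m 2 * v 0 - γ₁ - m 0) * (m 2 * v 1 - γ₂ - m 1) : ℝ) * hE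
    rw [hprod, abs_mul, abs_mul] at h1
    refine lt_of_le_of_lt ?_ h1
    push_cast
    gcongr
    · exact intDist_nonneg _
    · exact intDist_le _ _
    · exact intDist_le _ _

theorem propCFirst_of_dense {v : Fin 2 → ℝ}
    (hdense : Dense {x : SL3R ⧸ SL3Z | ∃ t : ℝ, 0 < t ∧
      x = QuotientGroup.mk (aMat3 t * uMat3 v)}) : PropCFirst v := by
  intro γ₀ δ M hδ hM
  obtain ⟨g, hg⟩ := exists_robust
  obtain ⟨c, hc, hloc⟩ := hg δ hδ
  obtain ⟨U, hU, hUo, hgU⟩ := eventually_nhds_iff.1 hloc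
  obtain ⟨t, ht, γ, hγ, hmem⟩ := exists_mem_of_dense hdense (hUo.preimage continuous_dual)
    ⟨dual g, by rwa [Set.mem_preimage, dual_dual]⟩ (Real.log (M / c) / 2)
  obtain ⟨n, w, hw, h1, -, h2⟩ := hU _ hmem ![0, 0, -(Real.exp (2 * t) * γ₀)]
  obtain ⟨m, hm⟩ := exists_int_mulVec (dual_mem hγ) n
  rw [dual_mul, dual_mul, coe_mul_mulVec, coe_mul_mulVec, hm, dual_uMat3_mulVec, dual_aMat3,
    aMat3_mulVec] at hw
  have hE : Real.exp (2 * t) * (Real.exp (-t) * Real.exp (-t)) = 1 := by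
    rw [← Real.exp_add, ← Real.exp_add, ← Real.exp_zero]
    congr 1
    ring
  have hw01 : w 0 * w 1 = (Real.exp (-t) * Real.exp (-t)) * (m 0 * m 1) := by
    simp [hw]
    ring
  refine ⟨m 0, m 1, ?_, ?_⟩
  · have h3 := lt_exp_mul hM hc ht
    rw [hw01, abs_mul, abs_of_pos (by positivity)] at h2
    have h4 := mul_lt_mul_of_pos_left h2 (Real.exp_pos (2 * t))
    rw [← mul_assoc, hE, one_mul] at h4
    push_cast
    linarith
  · have hprod : ∏ i, w i = (m 0 * m 1) * (m 0 * v 0 + m 1 * v 1 - γ₀ - (-m 2 : ℤ)) := by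
      have hw2 : w 2 = Real.exp (2 * t) * (m 0 * v 0 + m 1 * v 1 - γ₀ - (-m 2 : ℤ)) := by
        simp [hw]
        ring
      rw [Fin.prod_univ_three, hw01, hw2]
      linear_combination ((m 0 * m 1) * (m 0 * v 0 + m 1 * v 1 - γ₀ - (-m 2 : ℤ)) : ℝ) * hE
    rw [hprod, abs_mul] at h1
    refine lt_of_le_of_lt ?_ h1
    push_cast
    gcongr
    exact_mod_cast intDist_le _ (-m 2)

theorem not_isDI_of_dense {v : Fin 2 → ℝ}
    (hdense : Dense {x : SL3R ⧸ SL3Z | ∃ t : ℝ, 0 < t ∧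
      x = QuotientGroup.mk (aMat3 t * uMat3 v)}) : ¬ IsDI v := by
  rintro ⟨μ₀, hμ0, hμ1, N₀, hN⟩
  set d : ℝ := (1 - μ₀) / 2 with hd
  have hd0 : 0 < d := by rw [hd]; linarith
  have hd1 : d < 1 / 2 := by rw [hd]; linarith
  have hμd : 0 < 1 - d := by linarith
  set g : SL3R := aMat3 (Real.log (1 - d)) with hg
  set W : Set SL3R := {h | ∀ i j, |((g * h⁻¹).1 - 1) i j| < d / 6} with hW
  have hWo : IsOpen W := by
    simp only [hW, Set.ofPred_forall]
    refine isOpen_iInter_of_finite fun i => isOpen_iInter_of_finite fun j => ?_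
    refine isOpen_lt (Continuous.abs ?_) continuous_const
    exact ((continuous_entry i j).comp (continuous_const.mul continuous_inv)).sub continuous_const
  have hWg : g ∈ W := by
    intro i j
    rw [mul_inv_cancel]
    simpa using hd0
  obtain ⟨t, ht, γ, hγ, hmem⟩ := exists_mem_of_dense hdense hWo ⟨g, hWg⟩ (Real.log (max N₀ 1))
  have htN : N₀ ≤ Real.exp t := by
    refine (le_max_left N₀ 1).trans ?_
    rw [← Real.exp_log (lt_max_of_lt_right one_pos : 0 < max N₀ 1)]
    exact (Real.exp_lt_exp.2 ht).le
  obtain ⟨m, k, hk, hkN, hmk⟩ := hN _ htN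
  obtain ⟨n, hn⟩ := exists_int_mulVec (SL3Z.inv_mem hγ) ![m 0, m 1, k]
  have hn' : γ.1 *ᵥ (fun i => (n i : ℝ)) = fun i => ((![m 0, m 1, (k : ℤ)] i : ℤ) : ℝ) := by
    rw [← hn, ← coe_mul_mulVec, mul_inv_cancel]
    exact Matrix.one_mulVec _
  set h := aMat3 t * uMat3 v * γ with hh
  set w := h.1 *ᵥ (fun i => (n i : ℝ)) with hw
  have hw' := orbit_mulVec t v hn'
  rw [← hh, ← hw] at hw'
  have hwi : ∀ i : Fin 2, |Real.exp t * (m i - v i * k)| < μ₀ := fun i => by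
    have h1 := hmk i
    rw [lt_div_iff₀ (Real.exp_pos t)] at h1
    rw [abs_mul, abs_of_pos (Real.exp_pos t), mul_comm, abs_sub_comm, mul_comm (v i)]
    exact h1
  have hw0 : |w 0| < μ₀ := by simpa [hw'] using hwi 0
  have hw1 : |w 1| < μ₀ := by simpa [hw'] using hwi 1
  have hw2e : w 2 = Real.exp (-(2 * t)) * k := by simp [hw']
  have hw2pos : 0 < w 2 := by
    rw [hw2e]
    have : (0 : ℝ) < k := by exact_mod_cast hk
    positivity
  have hw2 : |w 2| ≤ 1 := by
    rw [abs_of_pos hw2pos, hw2e]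
    calc _ ≤ Real.exp (-(2 * t)) * Real.exp t ^ 2 := by gcongr
      _ = 1 := by
        rw [sq, ← Real.exp_add, ← Real.exp_add, ← Real.exp_zero]
        congr 1
        ring
  have hwle : ∀ i, |w i| ≤ 1 := fun i => by
    fin_cases i
    · exact (hw0.trans hμ1).le
    · exact (hw1.trans hμ1).le
    · exact hw2
  have hgn : g.1 *ᵥ (fun i => (n i : ℝ)) = w + ((g * h⁻¹).1 - 1) *ᵥ w := by
    rw [Matrix.sub_mulVec, Matrix.one_mulVec, coe_mul_mulVec, hw, inv_mulVec_mulVec]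
    abel
  have herr : ∀ i, |(((g * h⁻¹).1 - 1) *ᵥ w) i| ≤ d / 2 := fun i => by
    calc _ ≤ ∑ j, |((g * h⁻¹).1 - 1) i j * w j| := Finset.abs_sum_le_sum_abs _ _
      _ ≤ ∑ j : Fin 3, d / 6 * 1 := by
        refine Finset.sum_le_sum fun j _ => ?_
        rw [abs_mul]
        exact mul_le_mul (hmem i j).le (hwle j) (abs_nonneg _) (by positivity)
      _ = d / 2 := by simp; ring
  have hexp : Real.exp (-(2 * Real.log (1 - d))) = ((1 - d) ^ 2)⁻¹ := by
    rw [Real.exp_neg, two_mul, Real.exp_add, Real.exp_log hμd, sq]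
  have hgv : g.1 *ᵥ (fun i => (n i : ℝ)) =
      ![(1 - d) * n 0, (1 - d) * n 1, ((1 - d) ^ 2)⁻¹ * n 2] := by
    rw [hg, aMat3_mulVec, Real.exp_log hμd, hexp]
  rw [hgv] at hgn
  have hzero : ∀ (z : ℤ) (s : ℝ), 0 < s → |s * (z : ℝ)| < s → z = 0 := fun z s hs hlt => by
    rw [abs_mul, abs_of_pos hs] at hlt
    have h1 : |(z : ℝ)| < 1 := by
      by_contra! hcon
      exact absurd hlt (not_lt.2 (le_mul_of_one_le_right hs.le hcon))
    exact Int.abs_lt_one_iff.1 (by exact_mod_cast h1)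
  have hbd : ∀ i, |(w + ((g * h⁻¹).1 - 1) *ᵥ w : Fin 3 → ℝ) i| ≤ |w i| + d / 2 := fun i =>
    (abs_add_le _ _).trans (add_le_add_right (herr i) _)
  rw [← hgn] at hbd
  have n0 : n 0 = 0 := hzero _ _ hμd (by
    have := hbd 0
    simp only [Matrix.cons_val] at this
    linarith)
  have n1 : n 1 = 0 := hzero _ _ hμd (by
    have := hbd 1
    simp only [Matrix.cons_val] at this
    linarith)
  have n2 : n 2 = 0 := hzero _ _ (inv_pos.2 (pow_pos hμd 2)) (by
    have := hbd 2
    simp only [Matrix.cons_val] at this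
    refine (this.trans (add_le_add_left hw2 _)).trans_lt ?_
    rw [lt_inv_comm₀ (by positivity) (by positivity), inv_eq_one_div, lt_div_iff₀ (by positivity)]
    nlinarith [mul_pos hd0 hμd, mul_pos (mul_pos hd0 hμd) hd0])
  have hwz : w = 0 := by
    have : (fun i => (n i : ℝ)) = 0 := by
      ext i
      fin_cases i <;> simp [n0, n1, n2]
    rw [hw, this, Matrix.mulVec_zero]
  rw [hwz] at hw2pos
  exact lt_irrefl _ hw2pos

end SL3R

/-- if the orbit `{a_t u_v SL₃(ℤ)}_{t>0}` is dense in `SL₃(ℝ)/SL₃(ℤ)`, then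
`v` is not Dirichlet improvable and has property C. -/
theorem stmt8 (v : Fin 2 → ℝ)
    (hdense : Dense {x : SL3R ⧸ SL3Z | ∃ t : ℝ, 0 < t ∧
      x = QuotientGroup.mk (aMat3 t * uMat3 v)}) :
    ¬ IsDI v ∧ PropCFirst v ∧ PropCSecond v := by
  exact ⟨SL3R.not_isDI_of_dense hdense, SL3R.propCFirst_of_dense hdense,
    SL3R.propCSecond_of_dense hdense⟩
end

section
/- For every positive integer N there exists δ > 0 such that: for every irrational s ∈ (0,1) with c(s) = limsup_k a_k(s) < N, there exists T > 0 such that for all t > T, every nonzero vector of the lattice Λ_{t,s} = a_t u_s ℤ² has sup-norm at least δ. -/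
open Filter

/-- The Gauss map `G(x) = 1/x − ⌊1/x⌋`. -/
noncomputable def gaussMap (x : ℝ) : ℝ := Int.fract x⁻¹

/-- The `k`-th continued fraction coefficient `a_k(x) = ⌊1/G^(k−1)(x)⌋` (for `k ≥ 1`). -/
noncomputable def cfCoeff (x : ℝ) (k : ℕ) : ℤ := ⌊(gaussMap^[k - 1] x)⁻¹⌋

/-- `c(s) = limsup_k a_k(s)`, computed in the extended reals. -/
noncomputable def cfLimsup (s : ℝ) : EReal :=
  Filter.limsup (fun k : ℕ => ((cfCoeff s (k + 1) : ℝ) : EReal)) Filter.atTop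

/-- Numerators and denominators of the convergents both satisfy this recursion, with initial
values `(1, 0)` and `(0, 1)` respectively. -/
noncomputable def continuantSeq (s : ℝ) (u v : ℤ) : ℕ → ℤ
  | 0 => u
  | 1 => v
  | n + 2 => cfCoeff s (n + 1) * continuantSeq s u v (n + 1) + continuantSeq s u v n

/-- The product `s · G(s) ⋯ G^(n-1)(s)`, which is the distance `|q_n s - p_n|`. -/
noncomputable def gaussProd (s : ℝ) (n : ℕ) : ℝ := ∏ i ∈ Finset.range n, gaussMap^[i] s

lemma irrational_gaussMap {x : ℝ} (hx : Irrational x) : Irrational (gaussMap x) := by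
  unfold gaussMap Int.fract
  exact (irrational_inv_iff.2 hx).sub_intCast _

lemma gaussMap_mem_Ioo {x : ℝ} (hx : Irrational x) : gaussMap x ∈ Set.Ioo (0 : ℝ) 1 :=
  ⟨lt_of_le_of_ne (Int.fract_nonneg _) (irrational_gaussMap hx).ne_zero.symm, Int.fract_lt_one _⟩

lemma gaussMap_iterate_mem {s : ℝ} (hs : Irrational s) (h : s ∈ Set.Ioo (0 : ℝ) 1) (n : ℕ) :
    Irrational (gaussMap^[n] s) ∧ gaussMap^[n] s ∈ Set.Ioo (0 : ℝ) 1 := by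
  induction n with
  | zero => exact ⟨hs, h⟩
  | succ n ih =>
    rw [Function.iterate_succ_apply']
    exact ⟨irrational_gaussMap ih.1, gaussMap_mem_Ioo ih.1⟩

lemma one_le_cfCoeff_succ {s : ℝ} (hs : Irrational s) (h : s ∈ Set.Ioo (0 : ℝ) 1) (n : ℕ) :
    1 ≤ cfCoeff s (n + 1) := by
  have := (gaussMap_iterate_mem hs h n).2
  simp only [cfCoeff, Nat.add_sub_cancel]
  rw [Int.le_floor]
  exact_mod_cast (one_le_inv₀ this.1).2 this.2.le

lemma gaussProd_pos {s : ℝ} (hs : Irrational s) (h : s ∈ Set.Ioo (0 : ℝ) 1) (n : ℕ) :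
    0 < gaussProd s n :=
  Finset.prod_pos fun i _ => (gaussMap_iterate_mem hs h i).2.1

lemma gaussProd_succ_le {s : ℝ} (hs : Irrational s) (h : s ∈ Set.Ioo (0 : ℝ) 1) (n : ℕ) :
    gaussProd s (n + 1) ≤ gaussProd s n := by
  rw [gaussProd, Finset.prod_range_succ]
  exact mul_le_of_le_one_right (gaussProd_pos hs h n).le (gaussMap_iterate_mem hs h n).2.2.le

lemma gaussProd_add_two {s : ℝ} (hs : Irrational s) (h : s ∈ Set.Ioo (0 : ℝ) 1) (n : ℕ) :
    gaussProd s (n + 2) = gaussProd s n - cfCoeff s (n + 1) * gaussProd s (n + 1) := by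
  have hx := (gaussMap_iterate_mem hs h n).2.1.ne'
  simp only [gaussProd, Finset.prod_range_succ, cfCoeff, Nat.add_sub_cancel,
    Function.iterate_succ_apply']
  set x := gaussMap^[n] s
  have hg : gaussMap x = x⁻¹ - (⌊x⁻¹⌋ : ℝ) := rfl
  rw [hg]
  field_simp

lemma continuantSeq_mul_sub {s : ℝ} (hs : Irrational s) (h : s ∈ Set.Ioo (0 : ℝ) 1) (n : ℕ) :
    (continuantSeq s 0 1 n : ℝ) * s - continuantSeq s 1 0 n = -(-1) ^ n * gaussProd s n := by
  induction n using Nat.twoStepInduction with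
  | zero => simp [continuantSeq, gaussProd]
  | one => simp [continuantSeq, gaussProd]
  | more n h₀ h₁ =>
    rw [gaussProd_add_two hs h]
    simp only [continuantSeq]
    push_cast
    rw [pow_succ] at h₁
    rw [pow_add]
    linear_combination h₀ + (cfCoeff s (n + 1) : ℝ) * h₁

lemma continuantSeq_det (s : ℝ) (n : ℕ) :
    continuantSeq s 0 1 (n + 1) * continuantSeq s 1 0 n
      - continuantSeq s 0 1 n * continuantSeq s 1 0 (n + 1) = (-1) ^ n := by
  induction n with
  | zero => simp [continuantSeq]
  | succ n ih =>
    simp only [continuantSeq]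
    rw [pow_succ]
    linear_combination -ih

lemma continuantSeq_mul_gaussProd {s : ℝ} (hs : Irrational s) (h : s ∈ Set.Ioo (0 : ℝ) 1)
    (n : ℕ) :
    (continuantSeq s 0 1 (n + 1) : ℝ) * gaussProd s n
      + continuantSeq s 0 1 n * gaussProd s (n + 1) = 1 := by
  induction n with
  | zero => simp [continuantSeq, gaussProd]
  | succ n ih =>
    rw [gaussProd_add_two hs h]
    simp only [continuantSeq]
    push_cast
    linear_combination ih

lemma continuantSeq_bounds {s : ℝ} (hs : Irrational s) (h : s ∈ Set.Ioo (0 : ℝ) 1) (n : ℕ) :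
    (n : ℤ) ≤ continuantSeq s 0 1 (n + 1) ∧ 1 ≤ continuantSeq s 0 1 (n + 1) ∧
      0 ≤ continuantSeq s 0 1 n ∧ continuantSeq s 0 1 n ≤ continuantSeq s 0 1 (n + 1) := by
  have hle (n : ℕ) (hn : 0 ≤ continuantSeq s 0 1 (n + 1)) :
      continuantSeq s 0 1 (n + 1) + continuantSeq s 0 1 n ≤ continuantSeq s 0 1 (n + 1 + 1) := by
    rw [continuantSeq]
    nlinarith [one_le_cfCoeff_succ hs h n]
  have hpos (n : ℕ) : 0 ≤ continuantSeq s 0 1 n ∧ 1 ≤ continuantSeq s 0 1 (n + 1) := by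
    induction n with
    | zero => simp [continuantSeq]
    | succ n ih => have := hle n (by omega); omega
  induction n with
  | zero => simp [continuantSeq]
  | succ n ih =>
    have h₂ := hle n (by linarith [(hpos n).2])
    refine ⟨?_, (hpos _).2, (hpos _).1, by linarith [(hpos n).1]⟩
    rcases n with _ | n
    · simpa using (hpos 1).2
    · have := (hpos n).2
      push_cast at ih ⊢
      omega

/-- Best approximation: a nonzero integer vector whose denominator is smaller than `q_(n+1)`
approximates no better than the `n`-th convergent. -/
lemma gaussProd_le_abs_sub {s : ℝ} (hs : Irrational s) (h : s ∈ Set.Ioo (0 : ℝ) 1) (n : ℕ)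
    {m k : ℤ} (hmk : ¬(m = 0 ∧ k = 0)) (hk : |k| < continuantSeq s 0 1 (n + 1)) :
    gaussProd s n ≤ |(m : ℝ) - k * s| := by
  obtain ⟨-, h₁, h₀, -⟩ := continuantSeq_bounds hs h n
  have hdet := continuantSeq_det s n
  have e₀ := continuantSeq_mul_sub hs h n
  have e₁ := continuantSeq_mul_sub hs h (n + 1)
  have hD₀ := gaussProd_pos hs h n
  have hD₁ := gaussProd_pos hs h (n + 1)
  set q := continuantSeq s 0 1 n
  set q' := continuantSeq s 0 1 (n + 1)
  set p := continuantSeq s 1 0 n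
  set p' := continuantSeq s 1 0 (n + 1)
  have hsq : ((-1 : ℤ) ^ n) * (-1) ^ n = 1 := by rw [← mul_pow]; simp
  obtain ⟨u, w, hku, hmu⟩ : ∃ u w : ℤ, k = u * q + w * q' ∧ m = u * p + w * p' := by
    refine ⟨(-1) ^ n * (m * q' - k * p'), (-1) ^ n * (k * p - m * q), ?_, ?_⟩
    · linear_combination (-k) * hsq - (-1) ^ n * k * hdet
    · linear_combination (-m) * hsq - (-1) ^ n * m * hdet
  have hval : (m : ℝ) - k * s = (-1) ^ n * (u * gaussProd s n - w * gaussProd s (n + 1)) := by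
    rw [hku, hmu]
    push_cast
    rw [pow_succ] at e₁
    linear_combination (-(u : ℝ)) * e₀ - (w : ℝ) * e₁
  rw [hval, abs_mul, abs_pow, abs_neg, abs_one, one_pow, one_mul]
  obtain ⟨hk₁, hk₂⟩ := abs_lt.1 hk
  rcases lt_trichotomy u 0 with hu | hu | hu
  · have hw : 0 ≤ w := by
      by_contra! hw
      nlinarith
    have hu' : (u : ℝ) ≤ -1 := by exact_mod_cast Int.le_sub_one_of_lt hu
    have hw' : (0 : ℝ) ≤ w := by exact_mod_cast hw
    rw [le_abs]
    right
    nlinarith [mul_nonneg hw' hD₁.le]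
  · exfalso
    have hw : w ≠ 0 := by
      rintro rfl
      simp [hu] at hku hmu
      exact hmk ⟨hmu, hku⟩
    rcases lt_or_gt_of_ne hw with hw | hw <;> subst hu <;> nlinarith
  · have hw : w ≤ 0 := by
      by_contra! hw
      nlinarith
    have hu' : (1 : ℝ) ≤ u := by exact_mod_cast hu
    have hw' : (w : ℝ) ≤ 0 := by exact_mod_cast hw
    rw [le_abs]
    left
    nlinarith [mul_nonneg (neg_nonneg.2 hw') hD₁.le]

/-- If `a_(n+1) < N` then `q_(n+1) |q_(n+1) s - p_(n+1)|` is at least `1 / (N + 1)`. -/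
lemma inv_le_continuantSeq_mul_gaussProd {s : ℝ} (hs : Irrational s)
    (h : s ∈ Set.Ioo (0 : ℝ) 1) {N n : ℕ} (ha : cfCoeff s (n + 1) < N) :
    ((N : ℝ) + 1)⁻¹ ≤ continuantSeq s 0 1 (n + 1) * gaussProd s (n + 1) := by
  obtain ⟨-, h₁, h₀, h₂⟩ := continuantSeq_bounds hs h n
  have hone := continuantSeq_mul_gaussProd hs h (n + 1)
  have hD₀ := gaussProd_pos hs h (n + 1)
  have hD := gaussProd_succ_le hs h (n + 1)
  have hq : continuantSeq s 0 1 (n + 1 + 1) ≤ N * continuantSeq s 0 1 (n + 1) := by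
    rw [continuantSeq]
    nlinarith
  have hq' : (continuantSeq s 0 1 (n + 1 + 1) : ℝ) ≤ N * continuantSeq s 0 1 (n + 1) := by
    exact_mod_cast hq
  have h₁' : (1 : ℝ) ≤ continuantSeq s 0 1 (n + 1) := by exact_mod_cast h₁
  rw [inv_le_iff_one_le_mul₀ (by positivity)]
  have := mul_le_mul_of_nonneg_right hq' hD₀.le
  have := mul_le_mul_of_nonneg_left hD (zero_le_one.trans h₁')
  linarith

/-- for every positive integer `N` there is `δ > 0` such that for every
irrational `s ∈ (0,1)` with `c(s) < N`, for all sufficiently large `t` every nonzero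
vector of the lattice `Λ_{t,s} = a_t u_s ℤ²` has sup-norm at least `δ`. -/
theorem stmt10 (N : ℕ) (hN : 0 < N) :
    ∃ δ : ℝ, 0 < δ ∧ ∀ s : ℝ, Irrational s → s ∈ Set.Ioo (0 : ℝ) 1 →
      cfLimsup s < ((N : ℝ) : EReal) →
      ∃ T : ℝ, 0 < T ∧ ∀ t : ℝ, T < t → ∀ m k : ℤ, ¬(m = 0 ∧ k = 0) →
        δ ≤ max |Real.exp t * ((m : ℝ) - (k : ℝ) * s)| |Real.exp (-t) * (k : ℝ)| := by
  refine ⟨((N : ℝ) + 1)⁻¹, by positivity, fun s hs h hc => ?_⟩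
  obtain ⟨K, hK⟩ := eventually_atTop.1 (eventually_lt_of_limsup_lt hc)
  have hmono : Monotone (continuantSeq s 0 1) :=
    monotone_nat_of_le_succ fun n => (continuantSeq_bounds hs h n).2.2.2
  refine ⟨continuantSeq s 0 1 (K + 1), ?_, fun t ht m k hmk => ?_⟩
  · exact_mod_cast (continuantSeq_bounds hs h K).2.1
  have hex : ∃ n, Real.exp t < continuantSeq s 0 1 n := by
    obtain ⟨n, hn⟩ := exists_nat_gt (Real.exp t)
    exact ⟨n + 1, hn.trans_le (by exact_mod_cast (continuantSeq_bounds hs h n).1)⟩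
  classical
  obtain ⟨n, hn⟩ : ∃ n, Nat.find hex = K + 1 + n + 1 := by
    refine Nat.exists_eq_add_of_lt (lt_of_not_ge fun hle => ?_)
    have h₁ := Nat.find_spec hex
    have h₂ : (continuantSeq s 0 1 (Nat.find hex) : ℝ) ≤ continuantSeq s 0 1 (K + 1) := by
      exact_mod_cast hmono hle
    linarith [Real.add_one_le_exp t]
  have hlt : Real.exp t < continuantSeq s 0 1 (K + n + 1 + 1) := by
    have := Nat.find_spec hex
    rwa [hn, show K + 1 + n + 1 = K + n + 1 + 1 by ring] at this
  have hge : (continuantSeq s 0 1 (K + n + 1) : ℝ) ≤ Real.exp t :=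
    not_lt.1 (Nat.find_min hex (by omega))
  rw [le_max_iff]
  by_cases hk : ((N : ℝ) + 1)⁻¹ ≤ |Real.exp (-t) * (k : ℝ)|
  · exact Or.inr hk
  left
  have het := Real.exp_pos t
  have hkt : |(k : ℝ)| < Real.exp t := by
    have h₁ : |Real.exp (-t) * (k : ℝ)| < 1 :=
      (not_le.1 hk).trans_le (inv_le_one_of_one_le₀ (by linarith [N.cast_nonneg (α := ℝ)]))
    rw [abs_mul, Real.abs_exp, Real.exp_neg, inv_mul_lt_iff₀ het, mul_one] at h₁
    exact h₁
  have hkq : |k| < continuantSeq s 0 1 (K + n + 1 + 1) := by exact_mod_cast hkt.trans hlt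
  have ha : cfCoeff s (K + n + 1) < N := by
    have := hK (K + n) (by omega)
    rw [EReal.coe_lt_coe_iff] at this
    exact_mod_cast this
  rw [abs_mul, Real.abs_exp]
  calc ((N : ℝ) + 1)⁻¹
      ≤ continuantSeq s 0 1 (K + n + 1) * gaussProd s (K + n + 1) :=
        inv_le_continuantSeq_mul_gaussProd hs h ha
    _ ≤ Real.exp t * gaussProd s (K + n + 1) :=
        mul_le_mul_of_nonneg_right hge (gaussProd_pos hs h _).le
    _ ≤ Real.exp t * |(m : ℝ) - k * s| :=
        mul_le_mul_of_nonneg_left (gaussProd_le_abs_sub hs h _ hmk hkq) het.le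
end

section
/- Let s ∈ (0,1) be irrational. If the orbit {a_t u_s SL₂(ℤ) : t > 0} is dense in the quotient space SL₂(ℝ)/SL₂(ℤ) (with the quotient topology), then the continued fraction expansion of s contains all patterns. -/
open Matrix Filter

/-- `SL₂(ℝ)`. -/
abbrev SL2R := Matrix.SpecialLinearGroup (Fin 2) ℝ

/-- `SL₂(ℤ)` viewed as a subgroup of `SL₂(ℝ)`. -/
def SL2Z : Subgroup SL2R :=
  (Matrix.SpecialLinearGroup.map (n := Fin 2) (Int.castRingHom ℝ)).range

/-- The topology on `SL₂(ℝ)` is the subspace topology from the matrices, and the quotient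
`SL₂(ℝ)/SL₂(ℤ)` then carries the quotient topology. -/
noncomputable instance : TopologicalSpace SL2R :=
  TopologicalSpace.induced (fun g => (g : Matrix (Fin 2) (Fin 2) ℝ)) inferInstance

/-- `a_t = diag(e^t, e^{−t}) ∈ SL₂(ℝ)`. -/
noncomputable def aMat2 (t : ℝ) : SL2R :=
  ⟨!![Real.exp t, 0; 0, Real.exp (-t)], by
    simp [Matrix.det_fin_two, ← Real.exp_add]⟩

/-- `u_s = [[1, −s],[0, 1]] ∈ SL₂(ℝ)`. -/
def uMat2 (s : ℝ) : SL2R :=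
  ⟨!![1, -s; 0, 1], by simp [Matrix.det_fin_two]⟩

/-- The continued fraction expansion of `x` contains all patterns. -/
def ContainsAllPatterns (x : ℝ) : Prop :=
  ∀ (k : ℕ) (b : Fin k → ℕ), (∀ i, 0 < b i) →
    ∃ m : ℕ, ∀ i : Fin k, cfCoeff x (m + (i : ℕ) + 1) = (b i : ℤ)

/-- The sequences starting with a given pattern fill a nonempty open subset of `(0, 1)`. -/
lemma exists_isOpen_cfCoeff_eq (k : ℕ) (b : Fin k → ℕ) (hb : ∀ i, 0 < b i) :
    ∃ V : Set ℝ, IsOpen V ∧ V.Nonempty ∧ V ⊆ Set.Ioo 0 1 ∧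
      ∀ x ∈ V, ∀ i : Fin k, cfCoeff x ((i : ℕ) + 1) = (b i : ℤ) := by
  induction k with
  | zero => exact ⟨Set.Ioo 0 1, isOpen_Ioo, ⟨1 / 2, by norm_num⟩, subset_rfl, fun _ _ i => i.elim0⟩
  | succ k ih =>
    obtain ⟨V, hVo, ⟨v, hv⟩, hV01, hV⟩ := ih (fun i => b i.succ) fun i => hb _
    have hb0 : (1 : ℝ) ≤ b 0 := by exact_mod_cast hb 0
    refine ⟨Set.Ioi 0 ∩ (fun x : ℝ => x⁻¹ - b 0) ⁻¹' V, ?_, ⟨((b 0 : ℝ) + v)⁻¹, ?_, ?_⟩, ?_, ?_⟩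
    · refine ContinuousOn.isOpen_inter_preimage ?_ isOpen_Ioi hVo
      exact ((continuousOn_id (α := ℝ)).inv₀ fun x hx => ne_of_gt hx).sub continuousOn_const
    · have := (hV01 hv).1
      simp only [Set.mem_Ioi]
      positivity
    · simpa using hv
    · rintro x ⟨hx0, hx⟩
      have h := (hV01 hx).1
      refine ⟨hx0, ?_⟩
      have h1 : 1 < x⁻¹ := by linarith
      exact (one_lt_inv₀ hx0).1 h1
    · rintro x ⟨hx0, hx⟩ i
      rw [Set.mem_preimage] at hx
      have h := hV01 hx
      have hfl : ⌊x⁻¹⌋ = (b 0 : ℤ) := by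
        rw [Int.floor_eq_iff]
        constructor <;> push_cast <;> linarith [h.1, h.2]
      have hG : gaussMap x = x⁻¹ - b 0 := by
        rw [gaussMap, Int.fract, hfl]; simp
      refine Fin.cases ?_ (fun j => ?_) i
      · simpa [cfCoeff] using hfl
      · have := hV _ hx j
        rw [← hG] at this
        simpa [cfCoeff] using this

lemma gaussMap_inv_intCast_add {x : ℝ} (hx : x ∈ Set.Ioo (0 : ℝ) 1) (a : ℤ) :
    gaussMap (a + x)⁻¹ = x := by
  rw [gaussMap, inv_inv, Int.fract_intCast_add, Int.fract_eq_self]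
  exact ⟨hx.1.le, hx.2⟩

/-- A number in `(0, 1)` which is the image of `x ∈ (0, 1)` under a unimodular integral Möbius
transformation with denominators `q' > q > 0` has `x` in its orbit under the Gauss map. -/
lemma exists_gaussMap_iterate_eq {s : ℝ} (hs : s ∈ Set.Ioo (0 : ℝ) 1) (n : ℕ) :
    ∀ {x : ℝ} {p q p' q' : ℤ}, x ∈ Set.Ioo (0 : ℝ) 1 → q.toNat = n → 0 < q → q < q' →
      IsUnit (p' * q - p * q') → s * (q' + q * x) = p' + p * x →
      ∃ m : ℕ, gaussMap^[m] s = x := by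
  induction n using Nat.strong_induction_on with
  | _ n ih =>
  intro x p q p' q' hx hn hq hqq hdet hsx
  obtain rfl | hq1 : q = 1 ∨ 1 < q := by omega
  · have hq'2 : (2 : ℝ) ≤ q' := by exact_mod_cast hqq
    have hx0 := hx.1
    have hx1 := hx.2
    have hpos : 0 < (q' : ℝ) + x := by linarith
    push_cast at hsx
    rw [one_mul] at hsx
    rw [mul_one, Int.isUnit_iff] at hdet
    rcases hdet with h | h
    · have hp' : (p' : ℝ) = p * q' + 1 := by
        have : p' = p * q' + 1 := by linarith
        exact_mod_cast this
      have key : (s - p) * (q' + x) = 1 := by rw [hp'] at hsx; linear_combination hsx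
      have h1 : 0 < s - p := pos_of_mul_pos_left (by rw [key]; norm_num) hpos.le
      have h2 : s - p < 1 := by nlinarith
      have hp0 : p = 0 := by
        have h3 : (p : ℝ) < 1 := by linarith [hs.2]
        have h4 : (-1 : ℝ) < p := by linarith [hs.1]
        have h3' : p < 1 := by exact_mod_cast h3
        have h4' : -1 < p := by exact_mod_cast h4
        omega
      subst hp0
      refine ⟨1, ?_⟩
      have : s = (q' + x)⁻¹ := eq_inv_of_mul_eq_one_left (by simpa using key)
      rw [Function.iterate_one, this, gaussMap_inv_intCast_add hx]
    · have hp' : (p' : ℝ) = p * q' - 1 := by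
        have : p' = p * q' - 1 := by linarith
        exact_mod_cast this
      have key : (p - s) * (q' + x) = 1 := by rw [hp'] at hsx; linear_combination -hsx
      have h1 : 0 < p - s := pos_of_mul_pos_left (by rw [key]; norm_num) hpos.le
      have h2 : p - s < 1 := by nlinarith
      have hp1 : p = 1 := by
        have h3 : (p : ℝ) < 2 := by linarith [hs.2]
        have h4 : (0 : ℝ) < p := by linarith [hs.1]
        have h3' : p < 2 := by exact_mod_cast h3
        have h4' : 0 < p := by exact_mod_cast h4
        omega
      subst hp1
      set y : ℝ := (((q' - 1 : ℤ) : ℝ) + x)⁻¹ with hy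
      have hy1 : 1 < ((q' - 1 : ℤ) : ℝ) + x := by push_cast; linarith
      have hy01 : y ∈ Set.Ioo (0 : ℝ) 1 := ⟨by positivity, inv_lt_one_of_one_lt₀ hy1⟩
      have hsy : s = (((1 : ℤ) : ℝ) + y)⁻¹ := by
        apply eq_inv_of_mul_eq_one_left
        have hne : ((q' : ℝ) - 1 + x) ≠ 0 := by push_cast at hy1; linarith
        rw [hy]
        push_cast at key ⊢
        field_simp
        linear_combination -key
      refine ⟨2, ?_⟩
      rw [Function.iterate_succ_apply, Function.iterate_one, hsy, gaussMap_inv_intCast_add hy01, hy,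
        gaussMap_inv_intCast_add hx]
  · set a := q' / q with ha
    set r := q' % q
    have hdiv : q * a + r = q' := Int.mul_ediv_add_emod q' q
    have hr0 : 0 ≤ r := Int.emod_nonneg _ (by omega)
    have hrq : r < q := Int.emod_lt_of_pos _ hq
    have ha1 : 1 ≤ a := by
      rw [ha, Int.le_ediv_iff_mul_le hq]
      linarith
    have hdet' : IsUnit (p * r - (p' - a * p) * q) := by
      have : p * r - (p' - a * p) * q = -(p' * q - p * q') := by rw [← hdiv]; ring
      rw [this]
      exact hdet.neg
    have hr1 : 0 < r := by
      refine lt_of_le_of_ne hr0 fun h => ?_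
      rw [← h, mul_zero, zero_sub] at hdet'
      have : IsUnit q := isUnit_of_dvd_unit ⟨-(p' - a * p), by ring⟩ hdet'
      rw [Int.isUnit_iff] at this
      omega
    have ha1' : (1 : ℝ) ≤ a := by exact_mod_cast ha1
    have hax : 1 < (a : ℝ) + x := by linarith [hx.1]
    have hy01 : ((a : ℝ) + x)⁻¹ ∈ Set.Ioo (0 : ℝ) 1 :=
      ⟨by positivity, inv_lt_one_of_one_lt₀ hax⟩
    obtain ⟨m, hm⟩ := ih r.toNat (by omega) (p := p' - a * p) (p' := p) hy01 rfl hr1 hrq hdet' (by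
      have hne : (a : ℝ) + x ≠ 0 := by linarith
      have hq' : (q' : ℝ) = q * a + r := by exact_mod_cast hdiv.symm
      rw [hq'] at hsx
      push_cast
      field_simp
      linear_combination hsx)
    exact ⟨m + 1, by rw [Function.iterate_succ_apply', hm, gaussMap_inv_intCast_add hx]⟩

lemma isOpenMap_mk_SL2Z : IsOpenMap (QuotientGroup.mk : SL2R → SL2R ⧸ SL2Z) :=
  have : IsTopologicalGroup SL2R := Matrix.SpecialLinearGroup.topologicalGroup
  QuotientGroup.isOpenMap_coe

lemma continuous_SL2R_apply (i j : Fin 2) : Continuous fun g : SL2R => g i j :=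
  (continuous_induced_dom (f := fun g : SL2R => (g : Matrix (Fin 2) (Fin 2) ℝ))).matrix_elem i j

/-- if `s ∈ (0,1)` is irrational and the orbit `{a_t u_s SL₂(ℤ)}_{t>0}` is
dense in `SL₂(ℝ)/SL₂(ℤ)`, then the continued fraction expansion of `s` contains all
patterns. -/
theorem stmt11 (s : ℝ) (hs : Irrational s) (h01 : s ∈ Set.Ioo (0 : ℝ) 1)
    (hdense : Dense {x : SL2R ⧸ SL2Z | ∃ t : ℝ, 0 < t ∧
      x = QuotientGroup.mk (aMat2 t * uMat2 s)}) :
    ContainsAllPatterns s := by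
  intro k b hb
  obtain ⟨V, hVo, ⟨v, hv⟩, hV01, hV⟩ := exists_isOpen_cfCoeff_eq k b hb
  have hv01 := hV01 hv
  let U : Set SL2R := {g | 0 < g 1 1} ∩ {g | g 1 1 < g 1 0} ∩
    ({g | g 0 1 < 0} ∩ (fun g : SL2R => -g 0 0 / g 0 1) ⁻¹' V)
  have hUo : IsOpen U := by
    refine ((isOpen_lt continuous_const (continuous_SL2R_apply 1 1)).inter
      (isOpen_lt (continuous_SL2R_apply 1 1) (continuous_SL2R_apply 1 0))).inter
      (ContinuousOn.isOpen_inter_preimage ?_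
        (isOpen_lt (continuous_SL2R_apply 0 1) continuous_const) hVo)
    exact (continuous_SL2R_apply 0 0).neg.continuousOn.div
      (continuous_SL2R_apply 0 1).continuousOn fun g hg => ne_of_lt hg
  have hUne : U.Nonempty := by
    have hpos : 0 < v + 2 := by linarith [hv01.1]
    refine ⟨⟨!![v / (v + 2), -1 / (v + 2); 2, 1], ?_⟩, ⟨?_, ?_⟩, ?_, ?_⟩
    · rw [Matrix.det_fin_two_of]
      field_simp
      ring
    · change (0 : ℝ) < 1
      norm_num
    · change (1 : ℝ) < 2
      norm_num
    · change -1 / (v + 2) < 0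
      exact div_neg_of_neg_of_pos (by norm_num) hpos
    · have : -(v / (v + 2)) / (-1 / (v + 2)) = v := by field_simp
      change -(v / (v + 2)) / (-1 / (v + 2)) ∈ V
      rwa [this]
  obtain ⟨_, ⟨t, -, rfl⟩, g, hg, hgt⟩ :=
    hdense.exists_mem_open (isOpenMap_mk_SL2Z U hUo) (hUne.image _)
  obtain ⟨γ, hγ⟩ := QuotientGroup.eq.1 hgt.symm
  have hgγ : g = aMat2 t * uMat2 s * Matrix.SpecialLinearGroup.map (Int.castRingHom ℝ) γ := by
    rw [hγ, mul_inv_cancel_left]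
  have hmat : (g : Matrix (Fin 2) (Fin 2) ℝ) =
      !![Real.exp t, 0; 0, Real.exp (-t)] * !![1, -s; 0, 1] *
      !![(γ 0 0 : ℝ), (γ 0 1 : ℝ); (γ 1 0 : ℝ), (γ 1 1 : ℝ)] := by
    rw [hgγ, Matrix.SpecialLinearGroup.coe_mul, Matrix.SpecialLinearGroup.coe_mul]
    congr 1
    ext i j
    fin_cases i <;> fin_cases j <;> rfl
  have h00 : g 0 0 = Real.exp t * (γ 0 0 - s * γ 1 0) := by
    rw [hmat]; simp; ring
  have h01' : g 0 1 = Real.exp t * (γ 0 1 - s * γ 1 1) := by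
    rw [hmat]; simp; ring
  have h10 : g 1 0 = Real.exp (-t) * γ 1 0 := by
    rw [hmat]; simp
  have h11 : g 1 1 = Real.exp (-t) * γ 1 1 := by
    rw [hmat]; simp
  obtain ⟨⟨hg11, hg10⟩, hg01, hgV⟩ := hg
  simp only [Set.mem_ofPred_eq, Set.mem_preimage] at hg11 hg10 hg01 hgV
  obtain ⟨x, hx⟩ : ∃ x, -g 0 0 / g 0 1 = x := ⟨_, rfl⟩
  rw [hx] at hgV
  have hmul : g 0 0 + x * g 0 1 = 0 := by
    rw [← hx, div_mul_cancel₀ _ hg01.ne]; ring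
  rw [h00, h01'] at hmul
  rw [h11] at hg11 hg10
  rw [h10] at hg10
  have hq : 0 < γ 1 1 := by exact_mod_cast pos_of_mul_pos_right hg11 (Real.exp_pos _).le
  have hqq : γ 1 1 < γ 1 0 := by exact_mod_cast lt_of_mul_lt_mul_left hg10 (Real.exp_pos _).le
  obtain ⟨m, hm⟩ := exists_gaussMap_iterate_eq h01 _ (p := γ 0 1) (p' := γ 0 0) (hV01 hgV) rfl hq hqq
    (by rw [← Matrix.det_fin_two, γ.det_coe]; exact isUnit_one) (by
      have hexp := (Real.exp_pos t).ne'
      apply mul_left_cancel₀ hexp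
      linear_combination -hmul)
  refine ⟨m, fun i => ?_⟩
  rw [← hV _ hgV i, cfCoeff, cfCoeff, ← hm, ← Function.iterate_add_apply]
  congr 3
  omega
end

section
/- Let n be a positive integer and s ∈ ℝ. If the orbit {a_t u_{n·s} SL₂(ℤ) : t > 0} is dense in SL₂(ℝ)/SL₂(ℤ), then the orbit {a_t u_s SL₂(ℤ) : t > 0} is dense in SL₂(ℝ)/SL₂(ℤ). In other words, the set F = {s ∈ ℝ : the closure of {a_t u_s SL₂(ℤ)}_{t>0} is not all of SL₂(ℝ)/SL₂(ℤ)} satisfies: s ∈ F whenever n·s ∈ F... equivalently, n·s ∉ F implies s ∉ F, so F is invariant under multiplication by n modulo 1. -/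
open Matrix

open Set Filter Topology Pointwise

theorem isClosedEmbedding_coe_SL2R :
    IsClosedEmbedding (fun g : SL2R => (g : Matrix (Fin 2) (Fin 2) ℝ)) :=
  Matrix.SpecialLinearGroup.isClosedEmbedding_val

instance : IsTopologicalGroup SL2R := Matrix.SpecialLinearGroup.topologicalGroup

instance : T2Space SL2R := isClosedEmbedding_coe_SL2R.isEmbedding.t2Space

instance : LocallyCompactSpace SL2R :=
  have : LocallyCompactSpace (Matrix (Fin 2) (Fin 2) ℝ) :=
    inferInstanceAs (LocallyCompactSpace (Fin 2 → Fin 2 → ℝ))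
  isClosedEmbedding_coe_SL2R.locallyCompactSpace

theorem isClosed_SL2Z : IsClosed (SL2Z : Set SL2R) :=
  Real.isClosedEmbedding_intCast.specialLinearGroup_map.isClosed_range

instance : Countable (SL2Z : Set SL2R) :=
  have : Countable (Matrix.SpecialLinearGroup (Fin 2) ℤ) :=
    have : Countable (Matrix (Fin 2) (Fin 2) ℤ) := inferInstanceAs (Countable (Fin 2 → Fin 2 → ℤ))
    Subtype.val_injective.countable
  (MonoidHom.rangeRestrict_surjective _).countable

theorem continuous_SL2R_iff {X : Type*} [TopologicalSpace X] {f : X → SL2R} :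
    Continuous f ↔ ∀ i j, Continuous fun x => f x i j := by
  refine isClosedEmbedding_coe_SL2R.isInducing.continuous_iff.trans ?_
  exact continuous_pi_iff.trans (forall_congr' fun _ => continuous_pi_iff)

theorem coe_aMat2 (t : ℝ) :
    (aMat2 t : Matrix (Fin 2) (Fin 2) ℝ) = !![Real.exp t, 0; 0, Real.exp (-t)] := rfl

theorem coe_uMat2 (s : ℝ) : (uMat2 s : Matrix (Fin 2) (Fin 2) ℝ) = !![1, -s; 0, 1] := rfl

theorem continuous_aMat2 : Continuous aMat2 := by
  rw [continuous_SL2R_iff]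
  intro i j
  fin_cases i <;> fin_cases j <;> simp [coe_aMat2] <;> fun_prop

theorem continuous_uMat2 : Continuous uMat2 := by
  rw [continuous_SL2R_iff]
  intro i j
  fin_cases i <;> fin_cases j <;> simp [coe_uMat2] <;> fun_prop

theorem aMat2_add (t r : ℝ) : aMat2 (t + r) = aMat2 t * aMat2 r := by
  ext i j
  fin_cases i <;> fin_cases j <;>
    simp [coe_aMat2, Matrix.SpecialLinearGroup.coe_mul, Matrix.mul_apply, Fin.sum_univ_two, ← Real.exp_add, add_comm]

/-- The diagonal subgroup of `SL₂(ℝ)`, as a set. -/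
def diagonalSL2R : Set SL2R := {g | g 0 1 = 0 ∧ g 1 0 = 0}

theorem isClosed_diagonalSL2R : IsClosed diagonalSL2R := by
  have h := continuous_SL2R_iff.1 (continuous_id (X := SL2R))
  exact (isClosed_eq (h 0 1) continuous_const).inter (isClosed_eq (h 1 0) continuous_const)

theorem aMat2_mem_diagonalSL2R (t : ℝ) : aMat2 t ∈ diagonalSL2R := by
  constructor <;> simp [coe_aMat2]

theorem interior_diagonalSL2R : interior diagonalSL2R = ∅ := by
  rw [eq_empty_iff_forall_notMem]
  intro g hg
  have hcont : Continuous fun r : ℝ => uMat2 r * g := continuous_uMat2.mul continuous_const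
  have hu : uMat2 0 = 1 := by
    ext i j
    fin_cases i <;> fin_cases j <;> simp [coe_uMat2]
  have hnhds : (fun r : ℝ => uMat2 r * g) ⁻¹' interior diagonalSL2R ∈ 𝓝 (0 : ℝ) :=
    (isOpen_interior.preimage hcont).mem_nhds (by simpa [hu] using hg)
  obtain ⟨hg01, hg10⟩ := interior_subset hg
  have hdet : g 0 0 * g 1 1 = 1 := by
    have h := g.det_coe
    rw [Matrix.det_fin_two, hg01] at h
    simpa using h
  have hg11 : g 1 1 ≠ 0 := right_ne_zero_of_mul_eq_one hdet
  have hsub : (fun r : ℝ => uMat2 r * g) ⁻¹' interior diagonalSL2R ⊆ {0} := by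
    intro r hr
    have h := (interior_subset hr).1
    simpa [coe_uMat2, Matrix.SpecialLinearGroup.coe_mul, Matrix.mul_apply, Fin.sum_univ_two, hg01, hg11] using h
  have hopen := mem_of_superset hnhds hsub
  exact not_isOpen_singleton (0 : ℝ) (isOpen_singleton_iff_nhds_eq_pure _ |>.2
    (le_antisymm (le_pure_iff.2 hopen) (pure_le_nhds 0)))

section TopologicalGroup

variable {G : Type*} [Group G] [TopologicalSpace G] [IsTopologicalGroup G]

/-- A countable union of right translates of a closed set with empty interior is codense. -/
theorem dense_compl_mul_of_countable [BaireSpace G] {D T : Set G} (hD : IsClosed D)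
    (hint : interior D = ∅) (hT : T.Countable) : Dense (D * T)ᶜ := by
  have h : (D * T)ᶜ = ⋂ x ∈ T, (Homeomorph.mulRight x '' D)ᶜ := by
    ext g
    simp only [mem_compl_iff, Set.mem_mul, mem_iInter, mem_image, Homeomorph.coe_mulRight, not_exists,
      not_and]
    grind
  rw [h]
  refine dense_biInter_of_isOpen (fun x _ => ?_) hT fun x _ => ?_
  · exact ((Homeomorph.mulRight x).isClosedMap _ hD).isOpen_compl
  · rw [← interior_eq_empty_iff_dense_compl, ← Homeomorph.image_interior, hint, image_empty]

/-- If `S * Γ` is dense, then `S * Λ` is somewhere dense for every `Λ` of finite index in `Γ`. -/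
theorem nonempty_interior_closure_mul_of_finiteIndex [BaireSpace G] {K : Type*} [Group K]
    (f : K →* G) (Λ : Subgroup K) [Λ.FiniteIndex] {S : Set G}
    (hS : Dense (S * (f.range : Set G))) :
    (interior (closure (S * (Λ.map f : Set G)))).Nonempty := by
  have hcover : S * (f.range : Set G) ⊆
      ⋃ q : K ⧸ Λ, (fun g => g * f q.out) ⁻¹' closure (S * (Λ.map f : Set G)) := by
    rintro _ ⟨x, hx, _, ⟨k, rfl⟩, rfl⟩
    refine mem_iUnion.2 ⟨QuotientGroup.mk k⁻¹, subset_closure ?_⟩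
    refine ⟨x, hx, f (k * (QuotientGroup.mk (s := Λ) k⁻¹).out), ⟨_, ?_, rfl⟩, by simp [mul_assoc]⟩
    obtain ⟨l, hl⟩ := QuotientGroup.mk_out_eq_mul Λ k⁻¹
    rw [hl]
    simp
  have hclosed (q : K ⧸ Λ) :
      IsClosed ((fun g => g * f q.out) ⁻¹' closure (S * (Λ.map f : Set G))) :=
    isClosed_closure.preimage (continuous_mul_const _)
  have huniv := (hS.mono hcover).closure_eq
  rw [(isClosed_iUnion_of_finite hclosed).closure_eq] at huniv
  obtain ⟨q, g, hg⟩ := nonempty_interior_of_iUnion_of_closed hclosed huniv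
  refine ⟨g * f q.out, ?_⟩
  have h := (Homeomorph.mulRight (f q.out)).preimage_interior
    (closure (S * (Λ.map f : Set G)))
  exact h.symm.subset hg

end TopologicalGroup

/-- The tail of the forward `a_t`-orbit of `x`, for times `t > r`. -/
def forwardTail (r : ℝ) (x : SL2R) : Set SL2R := (fun t => aMat2 t * x) '' Ioi r

theorem dense_forwardTail_mul {x : SL2R} (h : Dense (forwardTail 0 x * (SL2Z : Set SL2R)))
    (r : ℝ) : Dense (forwardTail r x * (SL2Z : Set SL2R)) := by
  set C : Set SL2R := (fun t => aMat2 t * x) '' Icc 0 r * (SL2Z : Set SL2R) with hC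
  have hclosed : IsClosed C := isClosed_SL2Z.mul_left_of_isCompact
    (isCompact_Icc.image (continuous_aMat2.mul continuous_const))
  have hdense : Dense Cᶜ := by
    refine (dense_compl_mul_of_countable isClosed_diagonalSL2R interior_diagonalSL2R
      (T := (x * ·) '' (SL2Z : Set SL2R)) ((to_countable (SL2Z : Set SL2R)).image _)).mono ?_
    refine compl_subset_compl.2 ?_
    rintro _ ⟨_, ⟨t, -, rfl⟩, γ, hγ, rfl⟩
    exact ⟨aMat2 t, aMat2_mem_diagonalSL2R t, x * γ, ⟨γ, hγ, rfl⟩, by simp [mul_assoc]⟩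
  refine (h.inter_of_isOpen_right hdense hclosed.isOpen_compl).mono ?_
  rintro _ ⟨⟨_, ⟨t, ht, rfl⟩, γ, hγ, rfl⟩, hnot⟩
  refine ⟨_, ⟨t, ?_, rfl⟩, γ, hγ, rfl⟩
  by_contra hle
  exact hnot ⟨_, ⟨t, ⟨le_of_lt ht, not_lt.1 hle⟩, rfl⟩, γ, hγ, rfl⟩

/-- In the presence of a dense forward orbit, a somewhere dense forward orbit is dense. -/
theorem dense_of_nonempty_interior_closure {x y : SL2R}
    (hy : Dense (forwardTail 0 y * (SL2Z : Set SL2R)))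
    (hx : (interior (closure (forwardTail 0 x * (SL2Z : Set SL2R)))).Nonempty) :
    Dense (forwardTail 0 x * (SL2Z : Set SL2R)) := by
  set W := closure (forwardTail 0 x * (SL2Z : Set SL2R)) with hW
  have hinv {t : ℝ} (ht : 0 < t) {γ : SL2R} (hγ : γ ∈ SL2Z) {g : SL2R} (hg : g ∈ W) :
      aMat2 t * g * γ ∈ W := by
    refine map_mem_closure (f := fun g => aMat2 t * g * γ) (by fun_prop) hg ?_
    rintro _ ⟨_, ⟨r, hr, rfl⟩, δ, hδ, rfl⟩
    refine ⟨_, ⟨t + r, add_pos ht hr, rfl⟩, δ * γ, SL2Z.mul_mem hδ hγ, ?_⟩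
    simp [aMat2_add, mul_assoc]
  obtain ⟨_, hgW, _, ⟨r, hr, rfl⟩, γ, hγ, rfl⟩ := hy.inter_open_nonempty _ isOpen_interior hx
  rw [← dense_closure]
  refine (dense_forwardTail_mul hy r).mono ?_
  rintro _ ⟨_, ⟨t, ht, rfl⟩, δ, hδ, rfl⟩
  have h := hinv (sub_pos.2 ht) (SL2Z.mul_mem (SL2Z.inv_mem hγ) hδ) (interior_subset hgW)
  have ha : aMat2 t = aMat2 (t - r) * aMat2 r := by rw [← aMat2_add, sub_add_cancel]
  simpa [ha, mul_assoc] using h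

theorem dense_orbit_iff (x : SL2R) :
    Dense {y : SL2R ⧸ SL2Z | ∃ t : ℝ, 0 < t ∧ y = QuotientGroup.mk (aMat2 t * x)} ↔
      Dense (forwardTail 0 x * (SL2Z : Set SL2R)) := by
  rw [← QuotientGroup.dense_image_mk]
  congr! 1
  ext y
  simp [forwardTail, eq_comm]

theorem aMat2_conj_uMat2 {n : ℕ} (hn : 0 < n) (s : ℝ) :
    aMat2 (-(Real.log n / 2)) * uMat2 (n * s) * aMat2 (Real.log n / 2) = uMat2 s := by
  have hn' : (0 : ℝ) < n := by exact_mod_cast hn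
  have he : Real.exp (Real.log n / 2) * Real.exp (Real.log n / 2) = n := by
    rw [← Real.exp_add, add_halves, Real.exp_log hn']
  have h0 := Real.exp_ne_zero (Real.log n / 2)
  ext i j
  fin_cases i <;> fin_cases j <;>
    simp [coe_aMat2, coe_uMat2, Matrix.SpecialLinearGroup.coe_mul, Matrix.mul_apply, Fin.sum_univ_two, Real.exp_neg]
  field_simp
  rw [pow_two, he]

theorem aMat2_conj_mem_SL2Z {n : ℕ} (hn : 0 < n) {γ : Matrix.SpecialLinearGroup (Fin 2) ℤ}
    (hγ : γ ∈ CongruenceSubgroup.Gamma n) :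
    aMat2 (-(Real.log n / 2)) * Matrix.SpecialLinearGroup.map (Int.castRingHom ℝ) γ *
      aMat2 (Real.log n / 2) ∈ SL2Z := by
  have hn' : (0 : ℝ) < n := by exact_mod_cast hn
  have he : Real.exp (Real.log n / 2) * Real.exp (Real.log n / 2) = n := by
    rw [← Real.exp_add, add_halves, Real.exp_log hn']
  have h0 := Real.exp_ne_zero (Real.log n / 2)
  obtain ⟨b, hb⟩ := (ZMod.intCast_zmod_eq_zero_iff_dvd _ _).1 (CongruenceSubgroup.Gamma_mem.1 hγ).2.1
  have hdet := γ.det_coe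
  rw [Matrix.det_fin_two, hb] at hdet
  refine ⟨⟨!![γ 0 0, b; γ 1 0 * n, γ 1 1], ?_⟩, ?_⟩
  · rw [Matrix.det_fin_two_of]
    linear_combination hdet
  have hbR : (γ 0 1 : ℝ) = n * b := by exact_mod_cast hb
  have hmap (δ : Matrix.SpecialLinearGroup (Fin 2) ℤ) (i j : Fin 2) :
      Matrix.SpecialLinearGroup.map (Int.castRingHom ℝ) δ i j = (δ i j : ℝ) := rfl
  ext i j
  refine (hmap _ i j).trans ?_
  simp only [Matrix.SpecialLinearGroup.coe_mul, coe_aMat2, Real.exp_neg, neg_neg,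
    Matrix.mul_apply, Fin.sum_univ_two, hmap]
  generalize Real.exp (Real.log n / 2) = e at he h0
  fin_cases i <;> fin_cases j <;> simp [hbR, ← he] <;>
    field_simp

/-- for a positive integer `n` and `s ∈ ℝ`, if the orbit
`{a_t u_{n·s} SL₂(ℤ)}_{t>0}` is dense in `SL₂(ℝ)/SL₂(ℤ)`, then so is the orbit
`{a_t u_s SL₂(ℤ)}_{t>0}`.  In other words, the set of `s` with non-dense orbit is
invariant under multiplication by `n` modulo 1. -/
theorem stmt12 (n : ℕ) (hn : 0 < n) (s : ℝ)
    (hdense : Dense {x : SL2R ⧸ SL2Z | ∃ t : ℝ, 0 < t ∧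
      x = QuotientGroup.mk (aMat2 t * uMat2 ((n : ℝ) * s))}) :
    Dense {x : SL2R ⧸ SL2Z | ∃ t : ℝ, 0 < t ∧
      x = QuotientGroup.mk (aMat2 t * uMat2 s)} := by
  rw [dense_orbit_iff] at hdense ⊢
  have : NeZero n := ⟨hn.ne'⟩
  refine dense_of_nonempty_interior_closure hdense ?_
  obtain ⟨g, hg⟩ := nonempty_interior_closure_mul_of_finiteIndex
    (Matrix.SpecialLinearGroup.map (n := Fin 2) (Int.castRingHom ℝ))
    (CongruenceSubgroup.Gamma n) hdense
  set τ := Real.log n / 2 with hτ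
  let φ : SL2R ≃ₜ SL2R := (Homeomorph.mulLeft (aMat2 (-τ))).trans (Homeomorph.mulRight (aMat2 τ))
  refine ⟨φ g, ?_⟩
  have hφg := mem_image_of_mem φ hg
  rw [φ.image_interior, φ.image_closure] at hφg
  refine interior_mono (closure_mono ?_) hφg
  rintro _ ⟨_, ⟨_, ⟨t, ht, rfl⟩, _, ⟨γ, hγ, rfl⟩, rfl⟩, rfl⟩
  refine ⟨_, ⟨t, ht, rfl⟩, _, aMat2_conj_mem_SL2Z hn hγ, ?_⟩
  have hcomm : aMat2 (-τ) * aMat2 t = aMat2 t * aMat2 (-τ) := by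
    rw [← aMat2_add, ← aMat2_add, add_comm]
  have hcancel (h : SL2R) : aMat2 τ * (aMat2 (-τ) * h) = h := by
    have h0 : aMat2 0 = 1 := by
      ext i j
      fin_cases i <;> fin_cases j <;> simp [coe_aMat2]
    rw [← mul_assoc, ← aMat2_add, add_neg_cancel, h0, one_mul]
  simp only [φ, Homeomorph.trans_apply, Homeomorph.coe_mulLeft, Homeomorph.coe_mulRight]
  rw [← aMat2_conj_uMat2 hn s, ← hτ]
  simp only [mul_assoc, hcancel]
  rw [← mul_assoc (aMat2 (-τ)) (aMat2 t), hcomm, mul_assoc]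
end
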